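/- There are infinitely many combinatorially two-orbit LFC tilings of ℝ² with pairwise non-isomorphic face posets; that is, the set of order-isomorphism classes of face posets of combinatorially two-orbit LFC tilings of ℝ² is infinite. -/

import Mathlib

/-! Generic definitions about flags, flag orbits, and abstract polytopes. -/

variable {α : Type*} [PartialOrder α]

/-- Two flags (maximal chains) are in the same orbit of the automorphism group
(the group of order automorphisms) if some order automorphism maps one onto the other. -/
def SameFlagOrbit (Φ Ψ : Flag α) : Prop :=
  ∃ γ : α ≃o α, γ '' (Φ : Set α) = (Ψ : Set α)

/-- The automorphism group has exactly two orbits on the flags. -/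
def TwoFlagOrbits (α : Type*) [PartialOrder α] : Prop :=
  ∃ Φ Ψ : Flag α, ¬ SameFlagOrbit Φ Ψ ∧
    ∀ Ω : Flag α, SameFlagOrbit Ω Φ ∨ SameFlagOrbit Ω Ψ

/-- `Ψ` is the flag `Φ^i`: it differs from `Φ` in exactly the rank-`i` element
(with respect to the rank function `rk`). -/
def IsIAdjacent (rk : α → ℤ) (i : ℤ) (Φ Ψ : Flag α) : Prop :=
  Φ ≠ Ψ ∧ ∀ x : α, rk x ≠ i → (x ∈ Φ ↔ x ∈ Ψ)

/-- A two-orbit polytope (with rank function `rk`, adjacency indices `0, …, n-1`)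
is in class `2_I` if, for every flag `Φ` and every `i < n`, the `i`-adjacent flag `Φ^i`
lies in the same orbit as `Φ` exactly when `i ∈ I`. -/
def InClass (rk : α → ℤ) (n : ℕ) (I : Set ℕ) : Prop :=
  TwoFlagOrbits α ∧
    ∀ (Φ Ψ : Flag α) (i : ℕ), i < n → IsIAdjacent rk i Φ Ψ →
      (SameFlagOrbit Φ Ψ ↔ i ∈ I)

/-- An abstract polytope of rank `d`: a bounded poset, graded by a rank function `rk`
taking values `-1, 0, …, d`, in which every flag (maximal chain) has exactly one element
of each rank, satisfying the diamond condition and strong flag-connectivity. -/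
structure IsAbstractPolytope (α : Type*) [PartialOrder α] [BoundedOrder α]
    (rk : α → ℤ) (d : ℕ) : Prop where
  rk_bot : rk ⊥ = -1
  rk_top : rk ⊤ = d
  rk_strictMono : StrictMono rk
  rk_cover : ∀ x y : α, x ⋖ y → rk y = rk x + 1
  flag_ranks : ∀ (Φ : Flag α) (i : ℤ), -1 ≤ i → i ≤ d → ∃! x, x ∈ Φ ∧ rk x = i
  diamond : ∀ x y : α, x < y → rk y = rk x + 2 →
    ∃ a b : α, a ≠ b ∧ ∀ z : α, (x < z ∧ z < y) ↔ (z = a ∨ z = b)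
  connected : ∀ Φ Ψ : Flag α, ∃ (n : ℕ) (c : Fin (n + 1) → Flag α),
    c 0 = Φ ∧ c (Fin.last n) = Ψ ∧
    (∀ k : Fin n, ∃ i : ℤ, IsIAdjacent rk i (c k.castSucc) (c k.succ)) ∧
    (∀ k, (Φ : Set α) ∩ (Ψ : Set α) ⊆ (c k : Set α))
/-! Definitions about convex polytopes and their face lattices. -/

/-- Euclidean `d`-space. -/
abbrev EucSp (d : ℕ) : Type := EuclideanSpace ℝ (Fin d)

/-- A convex `d`-polytope: the convex hull of a finite set of points of `ℝ^d`,
with nonempty interior. -/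
def IsConvexPolytope {d : ℕ} (P : Set (EucSp d)) : Prop :=
  (∃ S : Finset (EucSp d), P = convexHull ℝ (S : Set (EucSp d))) ∧ (interior P).Nonempty

/-- The face lattice of `P`: the exposed faces of `P` (intersections of `P` with supporting
hyperplanes, together with `∅` and `P` itself), ordered by inclusion. -/
def Faces {d : ℕ} (P : Set (EucSp d)) : Type := {F : Set (EucSp d) // IsExposed ℝ P F}

noncomputable instance {d : ℕ} (P : Set (EucSp d)) : PartialOrder (Faces P) :=
  Subtype.partialOrder _

open scoped Classical

/-- The rank of a face: `-1` for the empty face, and otherwise its affine dimension. -/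
noncomputable def faceRank {d : ℕ} {P : Set (EucSp d)} (F : Faces P) : ℤ :=
  if F.1 = ∅ then -1
  else (Module.finrank ℝ (affineSpan ℝ F.1).direction : ℤ)
/-! Definitions about locally finite face-to-face tilings of Euclidean space by convex
polytopes (LFC tilings) and their face posets. -/

/-- An LFC tiling of `ℝ^d`: a face-to-face, locally finite tiling of `ℝ^d` by convex
`d`-polytopes. -/
structure IsLFCTiling {d : ℕ} (T : Set (Set (EucSp d))) : Prop where
  /-- Every tile is a convex `d`-polytope. -/
  polytope : ∀ t ∈ T, IsConvexPolytope t
  /-- The tiles cover all of `ℝ^d`. -/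
  covers : ⋃₀ T = Set.univ
  /-- The tiling is face-to-face: the intersection of any two tiles is a
  (possibly empty) face of each. -/
  face_to_face : ∀ t ∈ T, ∀ s ∈ T, IsExposed ℝ t (t ∩ s) ∧ IsExposed ℝ s (t ∩ s)
  /-- The tiling is locally finite: every bounded set meets only finitely many tiles. -/
  locally_finite : ∀ B : Set (EucSp d), Bornology.IsBounded B →
    {t ∈ T | (t ∩ B).Nonempty}.Finite

/-- The faces of the tiling `T`: all faces of all tiles (the empty face included). -/
def TFace {d : ℕ} (T : Set (Set (EucSp d))) : Type :=
  {F : Set (EucSp d) // ∃ t ∈ T, IsExposed ℝ t F}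

noncomputable instance {d : ℕ} (T : Set (Set (EucSp d))) : PartialOrder (TFace T) :=
  Subtype.partialOrder _

/-- The face poset of the tiling `T`: all faces of all tiles, together with a greatest
element, ordered by inclusion.  It is an abstract polytope of rank `d + 1`. -/
abbrev TPoset {d : ℕ} (T : Set (Set (EucSp d))) : Type := WithTop (TFace T)

/-- The rank of a subset of `ℝ^d` regarded as a face: `-1` for the empty face, and
otherwise its affine dimension. -/
noncomputable def setRank {d : ℕ} (F : Set (EucSp d)) : ℤ :=
  if F = ∅ then -1 else (Module.finrank ℝ (affineSpan ℝ F).direction : ℤ)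

/-- The rank function of the face poset of a tiling of `ℝ^d`: faces get their affine
dimension (`-1` for the empty face), and the greatest element gets rank `d + 1`. -/
noncomputable def tileRank {d : ℕ} (T : Set (Set (EucSp d))) : TPoset T → ℤ :=
  WithTop.recTopCoe ((d : ℤ) + 1) (fun F => setRank F.1)

/-- A tiling is normal if its tiles are uniformly bounded: for some `u, U > 0`, every tile
contains a ball of radius `u` and is contained in a ball of radius `U`. -/
def IsNormalTiling {d : ℕ} (T : Set (Set (EucSp d))) : Prop :=
  ∃ u U : ℝ, 0 < u ∧ 0 < U ∧ ∀ t ∈ T,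
    (∃ x, Metric.closedBall x u ⊆ t) ∧ (∃ x, t ⊆ Metric.closedBall x U)

noncomputable section
namespace TwoOrb

/-- Minkowski space. -/
abbrev V := Fin 3 → ℝ

/-- Lorentz form. -/
def Q (X Y : V) : ℝ := X 0 * Y 0 + X 1 * Y 1 - X 2 * Y 2

lemma Q_comm (X Y : V) : Q X Y = Q Y X := by unfold Q; ring
lemma Q_add_left (X Y Z : V) : Q (X + Y) Z = Q X Z + Q Y Z := by simp [Q]; ring
lemma Q_add_right (X Y Z : V) : Q Z (X + Y) = Q Z X + Q Z Y := by simp [Q]; ring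
lemma Q_sub_left (X Y Z : V) : Q (X - Y) Z = Q X Z - Q Y Z := by simp [Q]; ring
lemma Q_sub_right (X Y Z : V) : Q Z (X - Y) = Q Z X - Q Z Y := by simp [Q]; ring
lemma Q_smul_left (k : ℝ) (X Z : V) : Q (k • X) Z = k * Q X Z := by simp [Q]; ring
lemma Q_smul_right (k : ℝ) (X Z : V) : Q Z (k • X) = k * Q Z X := by simp [Q]; ring

/-- Parameters of the tiling: the two vertex degrees. -/
structure Par where
  p : ℕ
  q : ℕ
  hp : 5 ≤ p
  hq : 5 ≤ q

namespace Par
variable (P : Par)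

def a : ℝ := Real.cos (Real.pi / P.p)
def b : ℝ := Real.cos (Real.pi / P.q)
def c : ℝ := Real.sqrt (P.a ^ 2 + P.b ^ 2 - 1)

end Par

lemma cos_facts (n : ℕ) (hn : 5 ≤ n) :
    0 < Real.cos (Real.pi / n) ∧ Real.cos (Real.pi / n) < 1 ∧ 1 < 2 * Real.cos (Real.pi / n) ^ 2 := by
  have hpi := Real.pi_pos
  have hn' : (5 : ℝ) ≤ n := by exact_mod_cast hn
  have h0 : 0 < Real.pi / n := by positivity
  have h1 : Real.pi / n < Real.pi / 4 := by
    apply div_lt_div_of_pos_left hpi (by norm_num) (by linarith)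
  have h2 : Real.cos (Real.pi / 4) < Real.cos (Real.pi / n) :=
    Real.cos_lt_cos_of_nonneg_of_le_pi_div_two h0.le (by linarith) h1
  have h3 : Real.cos (Real.pi / n) < Real.cos 0 :=
    Real.cos_lt_cos_of_nonneg_of_le_pi_div_two le_rfl (by linarith) h0
  rw [Real.cos_zero] at h3
  rw [Real.cos_pi_div_four] at h2
  have h4 : 0 < Real.sqrt 2 := by positivity
  have h5 : Real.sqrt 2 ^ 2 = 2 := Real.sq_sqrt (by norm_num)
  refine ⟨by linarith, h3, by nlinarith⟩

namespace Par
variable (P : Par)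

lemma a_pos : 0 < P.a := (cos_facts P.p P.hp).1
lemma b_pos : 0 < P.b := (cos_facts P.q P.hq).1
lemma a_lt : P.a < 1 := (cos_facts P.p P.hp).2.1
lemma b_lt : P.b < 1 := (cos_facts P.q P.hq).2.1
lemma c_pos : 0 < P.c := Real.sqrt_pos.2 (by
  have := (cos_facts P.p P.hp).2.2
  have := (cos_facts P.q P.hq).2.2
  simp only [a, b]; linarith)
lemma c_sq : P.c ^ 2 = P.a ^ 2 + P.b ^ 2 - 1 := Real.sq_sqrt (by
  have := (cos_facts P.p P.hp).2.2
  have := (cos_facts P.q P.hq).2.2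
  simp only [a, b]; linarith)
lemma c_lt_a : P.c < P.a := by
  have := P.c_sq; have := P.a_pos; have := P.b_pos; have := P.b_lt; have := P.c_pos; nlinarith
lemma c_lt_b : P.c < P.b := by
  have := P.c_sq; have := P.a_pos; have := P.b_pos; have := P.a_lt; have := P.c_pos; nlinarith

/-- Simple roots. -/
def rt : Fin 3 → V := ![![1, 0, 0], ![0, 1, 0], ![-P.a, -P.b, -P.c]]

/-- Coxeter matrix. -/
def m : Fin 3 → Fin 3 → ℕ := ![![1, 2, P.p], ![2, 1, P.q], ![P.p, P.q, 1]]

lemma m_symm (i j : Fin 3) : P.m i j = P.m j i := by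
  fin_cases i <;> fin_cases j <;> rfl

lemma two_le_m (i j : Fin 3) (h : i ≠ j) : 2 ≤ P.m i j := by
  have := P.hp; have := P.hq
  fin_cases i <;> fin_cases j <;> simp [m] at h ⊢ <;> omega

lemma Q_rt_self (i : Fin 3) : Q (P.rt i) (P.rt i) = 1 := by
  have := P.c_sq
  fin_cases i <;> simp [Q, rt]
  nlinarith

lemma Q_rt (i j : Fin 3) (h : i ≠ j) : Q (P.rt i) (P.rt j) = -Real.cos (Real.pi / P.m i j) := by
  fin_cases i <;> fin_cases j <;> simp [Q, rt, m, a, b] at h ⊢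

/-- Simple reflections. -/
def rl (i : Fin 3) : V →ₗ[ℝ] V where
  toFun X := X - (2 * Q X (P.rt i)) • P.rt i
  map_add' X Y := by rw [Q_add_left]; module
  map_smul' k X := by rw [Q_smul_left]; simp only [RingHom.id_apply]; module

lemma rl_apply (i : Fin 3) (X : V) : P.rl i X = X - (2 * Q X (P.rt i)) • P.rt i := rfl

lemma rl_invol (i : Fin 3) : Function.Involutive (P.rl i) := by
  intro X
  rw [rl_apply, rl_apply, Q_sub_left, Q_smul_left, Q_rt_self]
  module

def r (i : Fin 3) : V ≃ₗ[ℝ] V := LinearEquiv.ofInvolutive (P.rl i) (P.rl_invol i)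

lemma r_apply (i : Fin 3) (X : V) : P.r i X = X - (2 * Q X (P.rt i)) • P.rt i := rfl

lemma r_mul_self (i : Fin 3) : P.r i * P.r i = 1 := by
  ext1 X; exact P.rl_invol i X

lemma r_r (i : Fin 3) (X : V) : P.r i (P.r i X) = X := P.rl_invol i X

lemma r_self (i : Fin 3) : P.r i (P.rt i) = - P.rt i := by
  rw [r_apply, Q_rt_self]; module

lemma Q_r (i : Fin 3) (X Y : V) : Q (P.r i X) (P.r i Y) = Q X Y := by
  simp only [r_apply, Q_sub_left, Q_sub_right, Q_smul_left, Q_smul_right, Q_rt_self, Q_comm (P.rt i) Y]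
  ring

lemma det_r (i : Fin 3) : LinearEquiv.det (P.r i) = -1 := by
  ext
  rw [LinearEquiv.coe_det]
  have h : (P.r i : V →ₗ[ℝ] V) = P.rl i := rfl
  have hc := P.c_sq
  rw [h, ← LinearMap.det_toMatrix', Matrix.det_fin_three]
  simp only [LinearMap.toMatrix'_apply, rl_apply]
  fin_cases i <;> simp [Q, rt]
  · norm_num
  · norm_num
  · nlinarith

/-- The linear map of a word; the head of the list is the rightmost letter. -/
def wd : List (Fin 3) → (V ≃ₗ[ℝ] V)
  | [] => 1
  | s :: l => wd l * P.r s

@[simp] lemma wd_nil : P.wd [] = 1 := rfl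
lemma wd_cons (s l) : P.wd (s :: l) = P.wd l * P.r s := rfl
lemma wd_append (l l' : List (Fin 3)) : P.wd (l ++ l') = P.wd l' * P.wd l := by
  induction l with
  | nil => simp
  | cons s l ih => rw [List.cons_append, wd_cons, wd_cons, ih, mul_assoc]

lemma wd_reverse_mul (l : List (Fin 3)) : P.wd l.reverse * P.wd l = 1 := by
  induction l with
  | nil => simp
  | cons s l ih =>
    rw [List.reverse_cons, wd_append, wd_cons, wd_cons, wd_nil, one_mul]
    calc _ = P.r s * (P.wd l.reverse * P.wd l) * P.r s := by group
      _ = _ := by rw [ih, mul_one, r_mul_self]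

lemma det_wd (l : List (Fin 3)) : LinearEquiv.det (P.wd l) = (-1) ^ l.length := by
  induction l with
  | nil => simp
  | cons s l ih => rw [wd_cons, map_mul, ih, det_r, List.length_cons, pow_succ]

lemma parity (l l' : List (Fin 3)) (h : P.wd l = P.wd l') : l.length % 2 = l'.length % 2 := by
  have h1 := congrArg LinearEquiv.det h
  rw [det_wd, det_wd] at h1
  have h2 : ((-1 : ℝ)) ^ l.length = (-1) ^ l'.length := by
    have := congrArg (fun u : ℝˣ => (u : ℝ)) h1
    simpa using this
  rcases Nat.even_or_odd l.length with h3 | h3 <;> rcases Nat.even_or_odd l'.length with h4 | h4 <;>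
    simp only [h3.neg_one_pow, h4.neg_one_pow] at h2
  · rw [Nat.even_iff.1 h3, Nat.even_iff.1 h4]
  · norm_num at h2
  · norm_num at h2
  · rw [Nat.odd_iff.1 h3, Nat.odd_iff.1 h4]

/-- Reduced words. -/
def Red (l : List (Fin 3)) : Prop := ∀ l', P.wd l' = P.wd l → l.length ≤ l'.length

lemma exists_red (l : List (Fin 3)) : ∃ l', P.wd l' = P.wd l ∧ P.Red l' := by
  classical
  have hex : ∃ n, ∃ l', P.wd l' = P.wd l ∧ l'.length = n := ⟨_, l, rfl, rfl⟩
  obtain ⟨l', h1, h2⟩ := Nat.find_spec hex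
  refine ⟨l', h1, fun l'' h => ?_⟩
  rw [h2]
  exact Nat.find_min' hex ⟨l'', h.trans h1, rfl⟩

/-- Suffixes and prefixes of reduced words are reduced. -/
lemma Red.tail {l₁ l₂ : List (Fin 3)} (h : P.Red (l₁ ++ l₂)) : P.Red l₂ := by
  intro l' hl'
  have := h (l₁ ++ l') (by rw [wd_append, wd_append, hl'])
  simp at this; omega

lemma Red.init {l₁ l₂ : List (Fin 3)} (h : P.Red (l₁ ++ l₂)) : P.Red l₁ := by
  intro l' hl'
  have := h (l' ++ l₂) (by rw [wd_append, wd_append, hl'])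
  simp at this; omega

/-- Alternating words. -/
def alt (s t : Fin 3) : ℕ → List (Fin 3)
  | 0 => []
  | k + 1 => s :: alt t s k

lemma alt_length (s t : Fin 3) (k : ℕ) : (alt s t k).length = k := by
  induction k generalizing s t with
  | zero => rfl
  | succ k ih => simp [alt, ih]

def pick (s t : Fin 3) : ℕ → Fin 3
  | 0 => s
  | k + 1 => pick t s k

lemma pick_succ (s t : Fin 3) (k : ℕ) : pick s t (k+1) = pick t s k := rfl

lemma r_other (s t : Fin 3) (h : s ≠ t) :
    P.r t (P.rt s) = P.rt s + (2 * Real.cos (Real.pi / P.m s t)) • P.rt t := by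
  rw [r_apply, Q_rt P s t h]; module

lemma alt_apply (s t : Fin 3) (h : s ≠ t) (k : ℕ) (j : ℕ) :
    P.wd (alt t s k) (Real.sin ((j + 1) * (Real.pi / P.m s t)) • P.rt s
        + Real.sin (j * (Real.pi / P.m s t)) • P.rt t)
      = Real.sin ((j + k + 1) * (Real.pi / P.m s t)) • P.rt (pick s t k)
        + Real.sin ((j + k) * (Real.pi / P.m s t)) • P.rt (pick t s k) := by
  induction k generalizing s t j with
  | zero => simp [alt, pick]
  | succ k ih =>
    have key : P.r t (Real.sin ((j + 1) * (Real.pi / P.m s t)) • P.rt s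
        + Real.sin (j * (Real.pi / P.m s t)) • P.rt t)
        = Real.sin (((j + 1 : ℕ) + 1) * (Real.pi / P.m t s)) • P.rt t
        + Real.sin ((j + 1 : ℕ) * (Real.pi / P.m t s)) • P.rt s := by
      rw [map_add, map_smul, map_smul, r_self, r_other P s t h, m_symm P t s]
      push_cast
      set θ := Real.pi / P.m s t
      have e1 : Real.sin ((j + 1 + 1) * θ) = Real.sin ((j+1) * θ) * (2 * Real.cos θ) - Real.sin (j * θ) := by
        have e2 : ((j : ℝ) + 1 + 1) * θ = (j + 1) * θ + θ := by ring
        have e3 : (j : ℝ) * θ = (j + 1) * θ - θ := by ring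
        rw [e2, e3, Real.sin_add, Real.sin_sub]; ring
      rw [e1]; module
    show P.wd (alt s t k) (P.r t _) = _
    rw [key, ih t s h.symm (j + 1), pick_succ, pick_succ, m_symm P t s]
    push_cast
    have e1 : ((j : ℝ) + 1 + k + 1) = j + (k + 1) + 1 := by ring
    have e2 : ((j : ℝ) + 1 + k) = j + (k + 1) := by ring
    rw [e1, e2]

lemma sin_pos' (s t : Fin 3) (h : s ≠ t) : 0 < Real.sin (Real.pi / P.m s t) := by
  have hm : (2 : ℝ) ≤ P.m s t := by exact_mod_cast P.two_le_m s t h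
  have := Real.pi_pos
  apply Real.sin_pos_of_pos_of_lt_pi (by positivity)
  exact div_lt_self this (by linarith)

lemma alt_apply_root (s t : Fin 3) (h : s ≠ t) (k : ℕ) :
    Real.sin (Real.pi / P.m s t) • P.wd (alt t s k) (P.rt s)
      = Real.sin ((k + 1) * (Real.pi / P.m s t)) • P.rt (pick s t k)
        + Real.sin (k * (Real.pi / P.m s t)) • P.rt (pick t s k) := by
  have := P.alt_apply s t h k 0
  simpa using this

lemma wd_alt_root (s t : Fin 3) (h : s ≠ t) :
    P.wd (alt s t (P.m s t)) (P.rt s) = P.wd (alt t s (P.m s t)) (P.rt s) := by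
  have hs := P.sin_pos' s t h
  have hm := P.two_le_m s t h
  have hm0 : (P.m s t : ℝ) ≠ 0 := by positivity
  obtain ⟨k, hk⟩ : ∃ k, P.m s t = k + 1 := ⟨P.m s t - 1, by omega⟩
  have h1 := P.alt_apply_root s t h (P.m s t)
  have h2 := P.alt_apply_root s t h k
  set θ := Real.pi / P.m s t with hθ
  have hmθ : (P.m s t : ℝ) * θ = Real.pi := by rw [hθ]; field_simp
  have hkθ : ((k : ℝ) + 1) * θ = Real.pi := by rw [← hmθ, hk]; push_cast; ring
  have hkθ' : (k : ℝ) * θ = Real.pi - θ := by linarith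
  have e1 : ((P.m s t : ℝ) + 1) * θ = θ + Real.pi := by linarith
  rw [e1, hmθ, Real.sin_pi, Real.sin_add_pi] at h1
  rw [hkθ, hkθ', Real.sin_pi, Real.sin_pi_sub] at h2
  have h3 : P.wd (alt s t (P.m s t)) (P.rt s) = - P.wd (alt t s k) (P.rt s) := by
    rw [hk]
    show P.wd (alt t s k) (P.r s _) = _
    rw [r_self, map_neg]
  have h4 : pick s t (P.m s t) = pick t s k := by rw [hk, pick_succ]
  apply smul_right_injective V hs.ne'
  show Real.sin θ • _ = Real.sin θ • _
  rw [h3, h1, smul_neg, h2, h4]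
  module

lemma wd_alt_fix (s t : Fin 3) (X : V) (h1 : Q X (P.rt s) = 0) (h2 : Q X (P.rt t) = 0) (k : ℕ) :
    P.wd (alt s t k) X = X := by
  induction k generalizing s t with
  | zero => rfl
  | succ k ih =>
    show P.wd (alt t s k) (P.r s X) = _
    rw [r_apply, h1]; simp [ih t s h2 h1]

lemma braid (s t : Fin 3) (h : s ≠ t) :
    P.wd (alt s t (P.m s t)) = P.wd (alt t s (P.m s t)) := by
  ext1 X
  have hs := P.sin_pos' s t h
  have hg := P.Q_rt s t h
  have h1 := P.wd_alt_root s t h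
  have h2 := P.wd_alt_root t s h.symm
  rw [m_symm P t s] at h2
  have hcs := Real.sin_sq_add_cos_sq (Real.pi / P.m s t)
  set S := Real.sin (Real.pi / P.m s t)
  set K := Real.cos (Real.pi / P.m s t)
  set x := (Q X (P.rt s) + K * Q X (P.rt t)) / S ^ 2 with hx
  set y := (Q X (P.rt t) + K * Q X (P.rt s)) / S ^ 2 with hy
  set Z := X - x • P.rt s - y • P.rt t with hZ
  have hg' : Q (P.rt t) (P.rt s) = - K := by rw [Q_comm, hg]
  have hS : S ^ 2 ≠ 0 := by positivity
  have hK : K ^ 2 = 1 - S ^ 2 := by linarith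
  have z1 : Q Z (P.rt s) = 0 := by
    rw [hZ, Q_sub_left, Q_sub_left, Q_smul_left, Q_smul_left, Q_rt_self, hg', hx, hy]
    field_simp
    linear_combination (Q X (P.rt s)) * hK
  have z2 : Q Z (P.rt t) = 0 := by
    rw [hZ, Q_sub_left, Q_sub_left, Q_smul_left, Q_smul_left, Q_rt_self, hg, hx, hy]
    field_simp
    linear_combination (Q X (P.rt t)) * hK
  have hX : X = Z + x • P.rt s + y • P.rt t := by rw [hZ]; module
  rw [hX]
  simp only [map_add, map_smul, h1, h2, P.wd_alt_fix s t Z z1 z2, P.wd_alt_fix t s Z z2 z1]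

/-- Nonnegative combinations of the simple roots. -/
def Cone (X : V) : Prop := ∃ k : Fin 3 → ℝ, (∀ i, 0 ≤ k i) ∧ X = ∑ i, k i • P.rt i

lemma Cone.add {X Y : V} (hX : P.Cone X) (hY : P.Cone Y) : P.Cone (X + Y) := by
  obtain ⟨k, hk, rfl⟩ := hX
  obtain ⟨l, hl, rfl⟩ := hY
  exact ⟨fun i => k i + l i, fun i => add_nonneg (hk i) (hl i), by simp [add_smul, Finset.sum_add_distrib]⟩

lemma Cone.smul {X : V} (hX : P.Cone X) {x : ℝ} (hx : 0 ≤ x) : P.Cone (x • X) := by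
  obtain ⟨k, hk, rfl⟩ := hX
  exact ⟨fun i => x * k i, fun i => mul_nonneg hx (hk i), by simp [Finset.smul_sum, mul_smul]⟩

lemma cone_rt (i : Fin 3) : P.Cone (P.rt i) :=
  ⟨fun j => if j = i then 1 else 0, fun j => by dsimp; split_ifs <;> norm_num, by simp⟩

lemma red_no_double (s : Fin 3) (l : List (Fin 3)) : ¬ P.Red (s :: s :: l) := by
  intro h
  have := h l (by rw [wd_cons, wd_cons, mul_assoc, r_mul_self, mul_one])
  simp at this

/-- reduced words in two letters are alternating -/
lemma red_alt (s t : Fin 3) (u : List (Fin 3)) (hu : ∀ x ∈ u, x = s ∨ x = t)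
    (h : P.Red (s :: u)) : u = alt t s u.length := by
  induction u generalizing s t with
  | nil => rfl
  | cons x u ih =>
    have hx : x = t := by
      rcases hu x (by simp) with rfl | h'
      · exact absurd h (P.red_no_double _ _)
      · exact h'
    subst hx
    have := ih x s (fun y hy => (hu y (by simp [hy])).symm) (Red.tail P (l₁ := [s]) h)
    simp only [List.length_cons, alt]
    rw [← this]

lemma alt_add (s t : Fin 3) (k n : ℕ) : ∃ l, alt s t (n + k) = alt s t n ++ l := by
  induction n generalizing s t with
  | zero => exact ⟨_, rfl⟩
  | succ n ih =>
    obtain ⟨l, hl⟩ := ih t s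
    refine ⟨l, ?_⟩
    rw [show n + 1 + k = (n + k) + 1 by ring]
    simp [alt, hl]

lemma alt_not_red (s t : Fin 3) (h : s ≠ t) : ¬ P.Red (alt s t (P.m s t + 1)) := by
  intro hr
  obtain ⟨k, hk⟩ : ∃ k, P.m s t = k + 1 := ⟨P.m s t - 1, by have := P.two_le_m s t h; omega⟩
  have h1 : P.wd (alt s t (P.m s t + 1)) = P.wd (alt t s k) := by
    show P.wd (alt t s (P.m s t)) * P.r s = _
    rw [← P.braid s t h, hk]
    show P.wd (alt t s k) * P.r s * P.r s = _
    rw [mul_assoc, r_mul_self, mul_one]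
  have := hr _ h1.symm
  rw [alt_length, alt_length] at this
  omega

lemma dihedral_pos (s t : Fin 3) (h : s ≠ t) (u : List (Fin 3)) (hu : ∀ x ∈ u, x = s ∨ x = t)
    (hr : P.Red (s :: u)) : ∃ x y : ℝ, 0 ≤ x ∧ 0 ≤ y ∧ P.wd u (P.rt s) = x • P.rt s + y • P.rt t := by
  have hua := P.red_alt s t u hu hr
  set k := u.length with hk
  have hkm : k + 1 ≤ P.m s t := by
    by_contra hlt
    have : s :: u = alt s t (k + 1) := by rw [hua]; rfl
    rw [this] at hr
    obtain ⟨l, hl⟩ := alt_add s t (k - P.m s t) (P.m s t + 1)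
    rw [show P.m s t + 1 + (k - P.m s t) = k + 1 by omega] at hl
    rw [hl] at hr
    exact P.alt_not_red s t h (Red.init P hr)
  have hs := P.sin_pos' s t h
  have h1 := P.alt_apply_root s t h k
  rw [← hua] at h1
  have hm0 : (0 : ℝ) < P.m s t := by have := P.two_le_m s t h; positivity
  have hθ : 0 ≤ Real.pi / P.m s t := by have := Real.pi_pos; positivity
  have hkm' : ((k : ℝ) + 1) ≤ P.m s t := by exact_mod_cast hkm
  have hle : ((k : ℝ) + 1) * (Real.pi / P.m s t) ≤ Real.pi := by
    calc _ ≤ (P.m s t : ℝ) * (Real.pi / P.m s t) := by gcongr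
      _ = _ := by field_simp
  have p1 : 0 ≤ Real.sin ((k + 1) * (Real.pi / P.m s t)) :=
    Real.sin_nonneg_of_nonneg_of_le_pi (by positivity) hle
  have p2 : 0 ≤ Real.sin (k * (Real.pi / P.m s t)) :=
    Real.sin_nonneg_of_nonneg_of_le_pi (by positivity) (by nlinarith)
  set S := Real.sin (Real.pi / P.m s t)
  have h2 : P.wd u (P.rt s) = (S⁻¹ * Real.sin ((k + 1) * (Real.pi / P.m s t))) • P.rt (pick s t k)
        + (S⁻¹ * Real.sin (k * (Real.pi / P.m s t))) • P.rt (pick t s k) := by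
    rw [mul_smul, mul_smul, ← smul_add, ← h1, smul_smul, inv_mul_cancel₀ hs.ne', one_smul]
  have hpick : ∀ k : ℕ, (pick s t k = s ∧ pick t s k = t) ∨ (pick s t k = t ∧ pick t s k = s) := by
    intro k
    induction k with
    | zero => left; exact ⟨rfl, rfl⟩
    | succ k ih => rw [pick_succ, pick_succ]; tauto
  rcases hpick k with ⟨e1, e2⟩ | ⟨e1, e2⟩
  · exact ⟨_, _, mul_nonneg (inv_nonneg.2 hs.le) p1, mul_nonneg (inv_nonneg.2 hs.le) p2, by rw [h2, e1, e2]⟩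
  · exact ⟨_, _, mul_nonneg (inv_nonneg.2 hs.le) p2, mul_nonneg (inv_nonneg.2 hs.le) p1, by rw [h2, e1, e2, add_comm]⟩

/-- The positivity theorem of Tits. -/
theorem tits (n : ℕ) : ∀ (l : List (Fin 3)) (s : Fin 3), l.length = n → P.Red (s :: l) →
    P.Cone (P.wd l (P.rt s)) := by
  classical
  induction n using Nat.strong_induction_on with
  | _ n IH =>
    intro l s hl hr
    cases l with
    | nil => exact P.cone_rt s
    | cons t l₀ =>
      have hst : s ≠ t := by rintro rfl; exact P.red_no_double _ _ hr
      have hlr : P.Red (t :: l₀) := Red.tail P (l₁ := [s]) hr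
      -- factorizations
      have hex : ∃ k, ∃ v u : List (Fin 3), (∀ x ∈ u, x = s ∨ x = t) ∧ P.wd (u ++ v) = P.wd (t :: l₀) ∧
          u.length + v.length = n ∧ v.length = k :=
        ⟨l₀.length, l₀, [t], by simp, rfl, by simp at hl ⊢; omega, rfl⟩
      obtain ⟨v, u, hu, hw, hlen, hk⟩ := Nat.find_spec hex
      have hmin : ∀ v' u' : List (Fin 3), (∀ x ∈ u', x = s ∨ x = t) →
          P.wd (u' ++ v') = P.wd (t :: l₀) → u'.length + v'.length = n → v.length ≤ v'.length := by
        intro v' u' h1 h2 h3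
        rw [hk]; exact Nat.find_min' hex ⟨v', u', h1, h2, h3, rfl⟩
      have hvn : v.length < n := by
        have := hmin l₀ [t] (by simp) rfl (by simp at hl ⊢; omega)
        simp at hl; omega
      have huvr : P.Red (s :: (u ++ v)) := by
        intro l' hl'
        have := hr l' (by rw [hl', wd_cons, wd_cons, hw])
        simp at this hl ⊢; omega
      have step : ∀ x, (x = s ∨ x = t) → P.Red (x :: v) := by
        intro x hx
        by_contra hnr
        unfold Red at hnr
        push Not at hnr
        obtain ⟨v', hv', hlt⟩ := hnr
        have hpar := P.parity _ _ hv'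
        simp only [List.length_cons] at hlt hpar
        have hle : v'.length < v.length := by omega
        have hprod : P.wd ((u ++ [x]) ++ v') = P.wd (t :: l₀) := by
          rw [wd_append, wd_append, hv', ← hw, wd_append, wd_cons, wd_cons, wd_nil, one_mul,
            mul_assoc, ← mul_assoc (P.r x), r_mul_self, one_mul]
        have h1 := hlr _ hprod
        simp at h1 hl
        have := hmin v' (u ++ [x]) (by
          intro y hy
          rcases List.mem_append.1 hy with hy | hy
          · exact hu y hy
          · simp at hy; rw [hy]; exact hx) hprod (by simp; omega)
        omega
      obtain ⟨x, y, hx, hy, hxy⟩ := P.dihedral_pos s t hst u hu (Red.init P (l₁ := s :: u) (l₂ := v) huvr)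
      have c1 := IH v.length hvn v s rfl (step s (Or.inl rfl))
      have c2 := IH v.length hvn v t rfl (step t (Or.inr rfl))
      rw [← hw, wd_append, LinearEquiv.mul_apply, hxy, map_add, map_smul, map_smul]
      exact Cone.add P (Cone.smul P c1 hx) (Cone.smul P c2 hy)

end Par
end TwoOrb
end

noncomputable section
namespace TwoOrb
namespace Par
variable (P : Par)

/-- The triangle group. -/
def Γ : Subgroup (V ≃ₗ[ℝ] V) where
  carrier := Set.range P.wd
  mul_mem' := by
    rintro _ _ ⟨l, rfl⟩ ⟨l', rfl⟩
    exact ⟨l' ++ l, P.wd_append _ _⟩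
  one_mem' := ⟨[], rfl⟩
  inv_mem' := by
    rintro _ ⟨l, rfl⟩
    exact ⟨l.reverse, eq_inv_of_mul_eq_one_left (P.wd_reverse_mul l)⟩

lemma r_mem (i : Fin 3) : P.r i ∈ P.Γ := ⟨[i], by simp [wd_cons]⟩

lemma exists_red_of_mem {g} (hg : g ∈ P.Γ) : ∃ l, P.wd l = g ∧ P.Red l := by
  obtain ⟨l, rfl⟩ := hg
  exact P.exists_red l

lemma Q_wd (l : List (Fin 3)) (X Y : V) : Q (P.wd l X) (P.wd l Y) = Q X Y := by
  induction l generalizing X Y with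
  | nil => rfl
  | cons s l ih => rw [wd_cons, LinearEquiv.mul_apply, LinearEquiv.mul_apply, ih, Q_r]

lemma Q_inv {g} (hg : g ∈ P.Γ) (X Y : V) : Q (g X) (g Y) = Q X Y := by
  obtain ⟨l, rfl⟩ := hg; exact P.Q_wd l X Y

lemma inv_apply_self (g : V ≃ₗ[ℝ] V) (X : V) : g⁻¹ (g X) = X := by
  rw [← LinearEquiv.mul_apply, inv_mul_cancel]; rfl
lemma apply_inv_self (g : V ≃ₗ[ℝ] V) (X : V) : g (g⁻¹ X) = X := by
  rw [← LinearEquiv.mul_apply, mul_inv_cancel]; rfl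

lemma Q_move {g} (hg : g ∈ P.Γ) (X Y : V) : Q X (g Y) = Q (g⁻¹ X) Y := by
  rw [← P.Q_inv hg (g⁻¹ X) Y, apply_inv_self]

/-- The closed chamber. -/
def K (X : V) : Prop := ∀ i, 0 ≤ Q X (P.rt i)

lemma K_cone {X Y : V} (hX : P.K X) (hY : P.Cone Y) : 0 ≤ Q X Y := by
  obtain ⟨k, hk, rfl⟩ := hY
  simp only [Fin.sum_univ_three, Q_add_right, Q_smul_right]
  have := fun i => mul_nonneg (hk i) (hX i)
  have h0 := this 0; have h1 := this 1; have h2 := this 2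
  linarith

lemma Q_wd_cons (X Y : V) (s : Fin 3) (l : List (Fin 3)) :
    Q X (P.wd (s :: l) Y) = Q X (P.wd l Y) - 2 * Q Y (P.rt s) * Q X (P.wd l (P.rt s)) := by
  rw [wd_cons, LinearEquiv.mul_apply, r_apply, map_sub, map_smul, Q_sub_right, Q_smul_right]

lemma main_le {X Y : V} (hX : P.K X) (hY : P.K Y) {g} (hg : g ∈ P.Γ) : Q X (g Y) ≤ Q X Y := by
  obtain ⟨l, rfl, hl⟩ := P.exists_red_of_mem hg
  clear hg
  induction l with
  | nil => exact le_rfl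
  | cons s l ih =>
    have h1 := ih (Red.tail P (l₁ := [s]) hl)
    have h2 := P.K_cone hX (P.tits _ l s rfl hl)
    rw [Q_wd_cons]
    have := mul_nonneg (hY s) h2
    linarith

def A : V := ![0, P.c / P.b, 1]
def B : V := ![P.c / P.a, 0, 1]
def C : V := ![0, 0, 1]

lemma Q_C (X : V) : Q C X = - X 2 := by simp [Q, C]
lemma Q_C' (X : V) : Q X C = - X 2 := by simp [Q, C]

lemma Q_rt0 (X : V) : Q X (P.rt 0) = X 0 := by simp [Q, rt]
lemma Q_rt1 (X : V) : Q X (P.rt 1) = X 1 := by simp [Q, rt]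
lemma Q_rt2 (X : V) : Q X (P.rt 2) = - P.a * X 0 - P.b * X 1 + P.c * X 2 := by
  simp [Q, rt]; ring

lemma K_iff (X : V) : P.K X ↔ 0 ≤ X 0 ∧ 0 ≤ X 1 ∧ P.a * X 0 + P.b * X 1 ≤ P.c * X 2 := by
  unfold K
  rw [Fin.forall_fin_succ, Fin.forall_fin_two]
  have e1 : (Fin.succ 0 : Fin 3) = 1 := rfl
  have e2 : (Fin.succ 1 : Fin 3) = 2 := rfl
  rw [e1, e2, Q_rt0, Q_rt1, Q_rt2]
  constructor
  · rintro ⟨h1, h2, h3⟩; exact ⟨h1, h2, by linarith⟩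
  · rintro ⟨h1, h2, h3⟩; exact ⟨h1, h2, by linarith⟩

lemma K_A : P.K P.A := by
  have := P.b_pos; have := P.c_pos
  rw [K_iff]; simp only [A]; simp
  refine ⟨by positivity, ?_⟩
  field_simp; exact le_rfl
lemma K_B : P.K P.B := by
  have := P.a_pos; have := P.c_pos
  rw [K_iff]; simp only [B]; simp
  refine ⟨by positivity, ?_⟩
  field_simp; exact le_rfl
lemma K_C : P.K C := by
  have := P.c_pos
  rw [K_iff]; simp [C]; positivity

lemma K_unique {X : V} (hX : P.K X) {g} (hg : g ∈ P.Γ) (hY : P.K (g X)) : g X = X := by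
  have key : ∀ Z, P.K Z → Q Z (g X) = Q Z X := by
    intro Z hZ
    apply le_antisymm (P.main_le hZ hX hg)
    have := P.main_le hZ hY (inv_mem hg)
    rwa [inv_apply_self] at this
  have h1 := key _ P.K_A
  have h2 := key _ P.K_B
  have h3 := key _ P.K_C
  have := P.a_pos; have := P.b_pos; have := P.c_pos
  simp only [Q, A, B, C] at h1 h2 h3
  simp at h1 h2 h3
  rw [h3] at h1 h2
  have h4 : P.c / P.b * ((g X) 1 - X 1) = 0 := by linarith
  have h5 : P.c / P.a * ((g X) 0 - X 0) = 0 := by linarith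
  have h6 : P.c / P.b ≠ 0 := by positivity
  have h7 : P.c / P.a ≠ 0 := by positivity
  have h8 := (mul_eq_zero.1 h4).resolve_left h6
  have h9 := (mul_eq_zero.1 h5).resolve_left h7
  ext i; fin_cases i
  · show (g X) 0 = X 0; linarith
  · show (g X) 1 = X 1; linarith
  · exact h3

/-- An interior point of the chamber. -/
def x0 : V := ![P.c / P.a, P.c / P.b, 3]

lemma x0_rt (i : Fin 3) : P.c ≤ Q P.x0 (P.rt i) := by
  have ha := P.a_pos; have hb := P.b_pos; have hc := P.c_pos
  have := P.a_lt; have := P.b_lt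
  fin_cases i
  · show _ ≤ Q P.x0 (P.rt 0)
    rw [Q_rt0]; simp [x0]; rw [le_div_iff₀ ha]; nlinarith
  · show _ ≤ Q P.x0 (P.rt 1)
    rw [Q_rt1]; simp [x0]; rw [le_div_iff₀ hb]; nlinarith
  · show _ ≤ Q P.x0 (P.rt 2)
    rw [Q_rt2]; simp [x0]; field_simp; linarith

lemma K_x0 : P.K P.x0 := fun i => P.c_pos.le.trans (P.x0_rt i)

lemma cone_x0 {Y : V} (hY : P.Cone Y) (h1 : Q Y Y = 1) : P.c ≤ Q P.x0 Y := by
  obtain ⟨k, hk, rfl⟩ := hY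
  have hc := P.c_pos
  have ha := P.a_pos; have hb := P.b_pos
  have hs : 1 ≤ k 0 + k 1 + k 2 := by
    simp [Fin.sum_univ_three, Q, rt] at h1
    have h0 := hk 0; have h1' := hk 1; have h2 := hk 2
    have hcc := P.c_sq
    have e : 1 = k 0 ^ 2 + k 1 ^ 2 + k 2 ^ 2 - 2 * P.a * (k 0 * k 2) - 2 * P.b * (k 1 * k 2) := by
      rw [← h1]; linear_combination -(k 2 ^ 2) * hcc
    have p1 : 0 ≤ P.a * (k 0 * k 2) := by positivity
    have p2 : 0 ≤ P.b * (k 1 * k 2) := by positivity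
    have p3 : 0 ≤ k 0 * k 1 := by positivity
    have p4 : 0 ≤ k 0 * k 2 := by positivity
    have p5 : 0 ≤ k 1 * k 2 := by positivity
    nlinarith
  simp only [Fin.sum_univ_three, Q_add_right, Q_smul_right]
  have e0 := mul_le_mul_of_nonneg_left (P.x0_rt 0) (hk 0)
  have e1 := mul_le_mul_of_nonneg_left (P.x0_rt 1) (hk 1)
  have e2 := mul_le_mul_of_nonneg_left (P.x0_rt 2) (hk 2)
  nlinarith

/-- Forward time-like vectors. -/
def Fwd (X : V) : Prop := 0 < X 2 ∧ X 0 ^ 2 + X 1 ^ 2 < X 2 ^ 2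

lemma fwd_C : Fwd C := by simp [Fwd, C]
lemma fwd_x0 : Fwd P.x0 := by
  have := P.a_pos; have := P.b_pos; have := P.c_pos
  have h1 : P.c / P.a < 1 := (div_lt_one (by assumption)).2 P.c_lt_a
  have h2 : P.c / P.b < 1 := (div_lt_one (by assumption)).2 P.c_lt_b
  have h3 : 0 < P.c / P.a := by positivity
  have h4 : 0 < P.c / P.b := by positivity
  refine ⟨by simp [x0], ?_⟩
  simp only [x0]; simp
  nlinarith

lemma cs (x y u v : ℝ) {z w : ℝ} (hz : 0 ≤ z) (hw : 0 ≤ w) (h1 : x ^ 2 + y ^ 2 ≤ z ^ 2)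
    (h2 : u ^ 2 + v ^ 2 ≤ w ^ 2) : x * u + y * v ≤ z * w := by
  have h : (x * u + y * v) ^ 2 ≤ (z * w) ^ 2 := by
    have e1 : (x * u + y * v) ^ 2 ≤ (x ^ 2 + y ^ 2) * (u ^ 2 + v ^ 2) := by
      nlinarith [sq_nonneg (x * v - y * u)]
    have e2 : (x ^ 2 + y ^ 2) * (u ^ 2 + v ^ 2) ≤ z ^ 2 * w ^ 2 := by gcongr
    calc _ ≤ _ := e1
      _ ≤ _ := e2
      _ = _ := by ring
  exact le_of_sq_le_sq h (by positivity)
where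
  le_of_sq_le_sq {a b : ℝ} (h : a ^ 2 ≤ b ^ 2) (hb : 0 ≤ b) : a ≤ b := abs_le_of_sq_le_sq' h hb |>.2

lemma fwd_r {X : V} (hX : Fwd X) (i : Fin 3) : Fwd (P.r i X) := by
  obtain ⟨h1, h2⟩ := hX
  have hq := P.Q_r i X X
  have hz : 0 < (P.r i X) 2 := by
    fin_cases i
    · simpa [r_apply, rt] using h1
    · simpa [r_apply, rt] using h1
    · show 0 < (P.r 2 X) 2
      rw [r_apply, Q_rt2]
      simp [rt]
      have hc := P.c_pos
      have hcc := P.c_sq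
      have e : (2 * P.c * P.a) * X 0 + (2 * P.c * P.b) * X 1 ≤ Real.sqrt (4 * P.c ^ 2 * (1 + P.c ^ 2)) * X 2 := by
        apply cs _ _ _ _ (Real.sqrt_nonneg _) h1.le
        · rw [Real.sq_sqrt (by positivity)]
          apply le_of_eq
          rw [hcc]; linear_combination (4 * P.a ^ 2 + 4 * P.b ^ 2) * hcc
        · exact h2.le
      have e2 : Real.sqrt (4 * P.c ^ 2 * (1 + P.c ^ 2)) < 1 + 2 * P.c ^ 2 := by
        rw [Real.sqrt_lt' (by positivity)]; nlinarith
      nlinarith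
  refine ⟨hz, ?_⟩
  simp only [Q] at hq
  nlinarith

lemma fwd_g {g} (hg : g ∈ P.Γ) {X : V} (hX : Fwd X) : Fwd (g X) := by
  obtain ⟨l, rfl⟩ := hg
  induction l generalizing X with
  | nil => exact hX
  | cons s l ih => rw [wd_cons, LinearEquiv.mul_apply]; exact ih (P.fwd_r hX s)

lemma pair_le {X Y : V} (hX : Fwd X) (hY : Fwd Y) : - Q X Y ≤ 2 * X 2 * Y 2 := by
  have := cs (-X 0) (-X 1) (Y 0) (Y 1) hX.1.le hY.1.le (by linarith [hX.2]) hY.2.le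
  simp only [Q]; linarith

lemma pair_ge {X : V} (hX : Fwd X) : ∃ ε > 0, ∀ Y, Fwd Y → ε * Y 2 ≤ - Q X Y := by
  have h : Real.sqrt (X 0 ^ 2 + X 1 ^ 2) < X 2 := (Real.sqrt_lt' hX.1).2 hX.2
  refine ⟨X 2 - Real.sqrt (X 0 ^ 2 + X 1 ^ 2), by linarith, fun Y hY => ?_⟩
  have := cs (X 0) (X 1) (Y 0) (Y 1) (Real.sqrt_nonneg (X 0 ^ 2 + X 1 ^ 2)) hY.1.le
    (by rw [Real.sq_sqrt (by positivity)]) hY.2.le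
  simp only [Q]; nlinarith

lemma growth (l : List (Fin 3)) (hl : P.Red l) :
    2 * P.c ^ 2 * l.length ≤ - Q P.x0 (P.wd l P.x0) := by
  have hc := P.c_pos
  induction l with
  | nil =>
    have h := P.fwd_x0.2
    simp only [wd_nil, List.length_nil, LinearEquiv.coe_one, id, Q]
    push_cast; nlinarith
  | cons s l ih =>
    have h1 := ih (Red.tail P (l₁ := [s]) hl)
    have h2 := P.cone_x0 (P.tits _ l s rfl hl) (by rw [Q_wd, Q_rt_self])
    have h3 := P.x0_rt s
    rw [Q_wd_cons]
    have := mul_le_mul h3 h2 hc.le (hc.le.trans h3)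
    rw [List.length_cons]
    push_cast
    nlinarith

lemma two_C {g} (hg : g ∈ P.Γ) (X : V) : (g X) 2 = - Q (g⁻¹ C) X := by
  rw [← P.Q_move hg, Q_C]; ring

lemma disc {X : V} (hX : Fwd X) (M : ℝ) : {g | g ∈ P.Γ ∧ (g X) 2 ≤ M}.Finite := by
  obtain ⟨ε, hε, hX'⟩ := pair_ge hX
  have hc := P.c_pos
  obtain ⟨N, hN⟩ := exists_nat_gt (36 * (M / ε) / (2 * P.c ^ 2))
  apply ((List.finite_length_le (Fin 3) N).image P.wd).subset
  rintro g ⟨hg, hM⟩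
  obtain ⟨l, rfl, hl⟩ := P.exists_red_of_mem hg
  refine ⟨l, ?_, rfl⟩
  have h1 := P.growth l hl
  have hCi := P.fwd_g (inv_mem hg) fwd_C
  have h2 := pair_le P.fwd_x0 (P.fwd_g hg P.fwd_x0)
  rw [P.two_C hg] at h2 hM
  have h3 := pair_le hCi P.fwd_x0
  have h4 := hX' _ hCi
  rw [Q_comm X] at h4
  have e : P.x0 2 = 3 := rfl
  rw [e] at h2 h3
  have h5 : ((P.wd l)⁻¹ C) 2 ≤ M / ε := by rw [le_div_iff₀ hε]; linarith
  have h6 : 2 * P.c ^ 2 * l.length ≤ 36 * (M / ε) := by linarith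
  have h7 : (l.length : ℝ) ≤ 36 * (M / ε) / (2 * P.c ^ 2) := by
    rw [le_div_iff₀ (by positivity)]; linarith
  have : (l.length : ℝ) < N := by linarith
  show l.length ≤ N
  exact_mod_cast this.le

lemma disc' {X : V} (hX : Fwd X) (M : ℝ) : {g | g ∈ P.Γ ∧ - Q P.x0 (g X) ≤ M}.Finite := by
  obtain ⟨ε, hε, h⟩ := pair_ge P.fwd_x0
  apply (P.disc hX (M / ε)).subset
  rintro g ⟨hg, hM⟩
  refine ⟨hg, ?_⟩
  rw [le_div_iff₀ hε]
  have := h _ (P.fwd_g hg hX)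
  linarith

lemma Q_x0_r (Y : V) (i : Fin 3) (h : Q Y (P.rt i) < 0) : - Q P.x0 (P.r i Y) < - Q P.x0 Y := by
  rw [r_apply, Q_sub_right, Q_smul_right]
  have := P.x0_rt i; have := P.c_pos
  nlinarith

lemma exists_chamber {X : V} (hX : Fwd X) : ∃ g ∈ P.Γ, P.K (g X) := by
  obtain ⟨g, ⟨hg, hgm⟩, hmin⟩ := Set.exists_min_image _ (fun g => - Q P.x0 (g X))
    (P.disc' hX (- Q P.x0 X)) ⟨1, one_mem _, le_rfl⟩
  refine ⟨g, hg, fun i => ?_⟩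
  by_contra hlt
  push Not at hlt
  have h1 := P.Q_x0_r _ i hlt
  have := hmin (P.r i * g) ⟨mul_mem (P.r_mem i) hg, by
    rw [LinearEquiv.mul_apply]; linarith⟩
  simp only [LinearEquiv.mul_apply] at this
  linarith

lemma r0_apply (X : V) : P.r 0 X = ![- X 0, X 1, X 2] := by
  rw [r_apply, Q_rt0]; ext i; fin_cases i <;> simp [rt]; ring
lemma r1_apply (X : V) : P.r 1 X = ![X 0, - X 1, X 2] := by
  rw [r_apply, Q_rt1]; ext i; fin_cases i <;> simp [rt]; ring
lemma r2_two (X : V) : (P.r 2 X) 2 = X 2 + 2 * P.c * Q X (P.rt 2) := by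
  rw [r_apply]; simp [rt]; ring

lemma two_le {X : V} (hX : P.K X) {g} (hg : g ∈ P.Γ) : X 2 ≤ (g X) 2 := by
  have := P.main_le P.K_C hX hg
  rw [Q_C, Q_C] at this; linarith

/-- sign changes -/
lemma flip_mem (Y : V) : ∃ s ∈ P.Γ, s Y = ![|Y 0|, |Y 1|, Y 2] ∧
    (s = 1 ∨ s = P.r 0 ∨ s = P.r 1 ∨ s = P.r 0 * P.r 1) := by
  rcases le_or_gt 0 (Y 0) with h0 | h0 <;> rcases le_or_gt 0 (Y 1) with h1 | h1
  · refine ⟨1, one_mem _, ?_, by simp⟩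
    rw [abs_of_nonneg h0, abs_of_nonneg h1]
    ext i; fin_cases i <;> rfl
  · refine ⟨P.r 1, P.r_mem 1, ?_, by simp⟩
    rw [abs_of_nonneg h0, abs_of_neg h1, r1_apply]
  · refine ⟨P.r 0, P.r_mem 0, ?_, by simp⟩
    rw [abs_of_neg h0, abs_of_nonneg h1, r0_apply]
  · refine ⟨P.r 0 * P.r 1, mul_mem (P.r_mem 0) (P.r_mem 1), ?_, by simp⟩
    rw [abs_of_neg h0, abs_of_neg h1, LinearEquiv.mul_apply, r1_apply, r0_apply]; simp

lemma eq_case {X : V} (hX : P.K X) {g} (hg : g ∈ P.Γ) (h : (g X) 2 = X 2) :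
    ![|(g X) 0|, |(g X) 1|, X 2] = X := by
  obtain ⟨s, hs, hsY, -⟩ := P.flip_mem (g X)
  have hc := P.c_pos
  have hK : P.K ((s * g) X) := by
    rw [LinearEquiv.mul_apply, hsY, K_iff]
    refine ⟨abs_nonneg _, abs_nonneg _, ?_⟩
    by_contra hlt
    push Not at hlt
    have h1 := P.two_le hX (mul_mem (P.r_mem 2) (mul_mem hs hg))
    rw [LinearEquiv.mul_apply, r2_two, Q_rt2, LinearEquiv.mul_apply, hsY] at h1
    simp at h1 hlt
    rw [h] at h1 hlt
    nlinarith
  have := P.K_unique hX (mul_mem hs hg) hK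
  rw [LinearEquiv.mul_apply, hsY, h] at this
  exact this

end Par
end TwoOrb
end

noncomputable section
namespace TwoOrb
namespace Par
variable (P : Par)

lemma kappa : ∃ κ > 0, κ ≤ 1 ∧ ∀ Z, P.K Z → κ * Z 2 ^ 2 ≤ - Q Z Z := by
  have ha := P.a_pos; have hb := P.b_pos; have hc := P.c_pos
  obtain ⟨μ, hμ, hμa, hμb, hcμ⟩ : ∃ μ > 0, μ ≤ P.a ∧ μ ≤ P.b ∧ P.c < μ :=
    ⟨min P.a P.b, lt_min ha hb, min_le_left _ _, min_le_right _ _, lt_min P.c_lt_a P.c_lt_b⟩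
  have h1 : P.c / μ < 1 := (div_lt_one hμ).2 hcμ
  have h0 : 0 < P.c / μ := by positivity
  refine ⟨1 - (P.c / μ) ^ 2, by nlinarith, by nlinarith, fun Z hZ => ?_⟩
  rw [K_iff] at hZ
  obtain ⟨z0, z1, h⟩ := hZ
  have e : Z 0 + Z 1 ≤ P.c / μ * Z 2 := by
    rw [div_mul_eq_mul_div, le_div_iff₀ hμ]; nlinarith
  have e2 : (Z 0 + Z 1) ^ 2 ≤ (P.c / μ * Z 2) ^ 2 := by gcongr
  simp only [Q]
  nlinarith [mul_nonneg z0 z1]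

/-- planar radius -/
def rad (x y : ℝ) : ℝ := Real.sqrt (x ^ 2 + y ^ 2)

lemma rad_nonneg (x y : ℝ) : 0 ≤ rad x y := Real.sqrt_nonneg _
lemma rad_sq (x y : ℝ) : rad x y ^ 2 = x ^ 2 + y ^ 2 := Real.sq_sqrt (by positivity)

lemma low (R : ℝ) (hR : 0 ≤ R) : ∃ η > 0, ∀ x y, rad x y ≤ R →
    ∃ g ∈ P.Γ, - Q (g C) ![x, y, rad x y + η] < 1 := by
  obtain ⟨κ, hκ, hκ1, h⟩ := P.kappa
  have hη : 0 < κ / (2 * R + 2) := by positivity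
  refine ⟨κ / (2 * R + 2), hη, fun x y hxy => ?_⟩
  set η := κ / (2 * R + 2) with hη'
  have e1 : η * (2 * R + 2) = κ := by rw [hη']; field_simp
  have e2 : η ≤ 1 := by nlinarith
  have r0 := rad_nonneg x y
  have r1 := rad_sq x y
  set X : V := ![x, y, rad x y + η] with hX
  have hF : Fwd X := by
    refine ⟨?_, ?_⟩
    · show 0 < rad x y + η
      positivity
    · show x ^ 2 + y ^ 2 < (rad x y + η) ^ 2
      nlinarith
  obtain ⟨g, hg, hK⟩ := P.exists_chamber hF
  refine ⟨g⁻¹, inv_mem hg, ?_⟩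
  rw [← P.two_C hg]
  have h2 := h _ hK
  rw [P.Q_inv hg] at h2
  have h3 : - Q X X < κ := by
    show - (x * x + y * y - (rad x y + η) * (rad x y + η)) < κ
    nlinarith
  have := (P.fwd_g hg hF).1
  by_contra hcon
  push Not at hcon
  have h5 : 1 ≤ (g X) 2 ^ 2 := one_le_pow₀ hcon
  nlinarith

lemma cs_rad {Y : V} (hY : Fwd Y) (x y : ℝ) : Y 0 * x + Y 1 * y ≤ Y 2 * rad x y :=
  cs _ _ _ _ hY.1.le (rad_nonneg _ _) hY.2.le (by rw [rad_sq])

/-- the polyhedral surface -/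
def S : Set V := {X | (∀ k ∈ P.Γ, Q (k C) X ≤ -1) ∧ ∃ g ∈ P.Γ, Q (g C) X = -1}

/-- the tile of the surface -/
def tS (g : V ≃ₗ[ℝ] V) : Set V := {X | (∀ k ∈ P.Γ, Q (k C) X ≤ -1) ∧ Q (g C) X = -1}

lemma tS_sub {g} (hg : g ∈ P.Γ) : P.tS g ⊆ P.S := fun _ hX => ⟨hX.1, g, hg, hX.2⟩

lemma S_unique {X Y : V} (hX : X ∈ P.S) (hY : Y ∈ P.S) (h0 : X 0 = Y 0) (h1 : X 1 = Y 1) :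
    X = Y := by
  have key : ∀ X Y, X ∈ P.S → Y ∈ P.S → X 0 = Y 0 → X 1 = Y 1 → X 2 ≤ Y 2 := by
    intro X Y hX hY h0 h1
    obtain ⟨g, hg, h⟩ := hX.2
    have h' := hY.1 g hg
    have := (P.fwd_g hg fwd_C).1
    simp only [Q] at h h'
    rw [h0, h1] at h
    by_contra hlt
    push Not at hlt
    nlinarith
  have h2 := le_antisymm (key X Y hX hY h0 h1) (key Y X hY hX h0.symm h1.symm)
  ext i; fin_cases i
  · exact h0
  · exact h1
  · exact h2

lemma S_exists (x y : ℝ) : ∃ z, (![x, y, z] : V) ∈ P.S := by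
  obtain ⟨η, hη, h⟩ := P.low (rad x y) (rad_nonneg _ _)
  obtain ⟨g, hg, hlt⟩ := h x y le_rfl
  set f : (V ≃ₗ[ℝ] V) → ℝ := fun k => (1 + (k C) 0 * x + (k C) 1 * y) / (k C) 2 with hf
  have hfin : {k | k ∈ P.Γ ∧ rad x y + η ≤ f k}.Finite := by
    apply (P.disc fwd_C (1 / η)).subset
    rintro k ⟨hk, hle⟩
    refine ⟨hk, ?_⟩
    have hw := P.fwd_g hk fwd_C
    have := cs_rad hw x y
    rw [hf, le_div_iff₀ hw.1] at hle
    rw [le_div_iff₀ hη]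
    nlinarith
  have hne : {k | k ∈ P.Γ ∧ rad x y + η ≤ f k}.Nonempty := by
    refine ⟨g, hg, ?_⟩
    have hw := P.fwd_g hg fwd_C
    rw [hf, le_div_iff₀ hw.1]
    simp [Q] at hlt
    linarith
  obtain ⟨k0, ⟨hk0, hm⟩, hmax⟩ := Set.exists_max_image _ f hfin hne
  refine ⟨f k0, fun k hk => ?_, k0, hk0, ?_⟩
  · have hw := (P.fwd_g hk fwd_C).1
    have : f k ≤ f k0 := by
      by_cases hc : rad x y + η ≤ f k
      · exact hmax k ⟨hk, hc⟩
      · linarith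
    have e : f k * (k C) 2 = 1 + (k C) 0 * x + (k C) 1 * y := by
      rw [hf]; field_simp
    simp [Q]
    nlinarith
  · have hw := (P.fwd_g hk0 fwd_C).1
    have e : f k0 * (k0 C) 2 = 1 + (k0 C) 0 * x + (k0 C) 1 * y := by
      rw [hf]; field_simp
    simp [Q]
    linarith

lemma loc_fin (R : ℝ) : {g | g ∈ P.Γ ∧ ∃ X ∈ P.tS g, rad (X 0) (X 1) ≤ R}.Finite := by
  rcases lt_or_ge R 0 with hR | hR
  · convert Set.finite_empty
    ext g
    simp only [Set.mem_ofPred_eq, Set.mem_empty_iff_false, iff_false]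
    rintro ⟨-, X, -, h⟩
    linarith [rad_nonneg (X 0) (X 1)]
  obtain ⟨η, hη, h⟩ := P.low R hR
  apply (P.disc fwd_C (1 / η)).subset
  rintro k ⟨hk, X, hX, hr⟩
  refine ⟨hk, ?_⟩
  obtain ⟨g, hg, hlt⟩ := h _ _ hr
  have h1 := hX.1 g hg
  have h2 := hX.2
  have hw := P.fwd_g hk fwd_C
  have hw' := P.fwd_g hg fwd_C
  have h3 := cs_rad hw (X 0) (X 1)
  simp [Q] at hlt h1 h2
  have h4 : rad (X 0) (X 1) + η < X 2 := by
    by_contra hcon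
    push Not at hcon
    nlinarith [hw'.1]
  rw [le_div_iff₀ hη]
  nlinarith [hw.1]

lemma S_smul {g} (hg : g ∈ P.Γ) {X : V} (hX : X ∈ P.S) : g X ∈ P.S := by
  refine ⟨fun k hk => ?_, ?_⟩
  · rw [P.Q_move hg, ← LinearEquiv.mul_apply]
    exact hX.1 _ (mul_mem (inv_mem hg) hk)
  · obtain ⟨k, hk, h⟩ := hX.2
    refine ⟨g * k, mul_mem hg hk, ?_⟩
    rw [LinearEquiv.mul_apply, P.Q_inv hg, h]

lemma tS_smul {g} (hg : g ∈ P.Γ) (k : V ≃ₗ[ℝ] V) : g '' P.tS k = P.tS (g * k) := by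
  ext X
  constructor
  · rintro ⟨X, hX, rfl⟩
    refine ⟨fun l hl => ?_, ?_⟩
    · rw [P.Q_move hg, ← LinearEquiv.mul_apply]
      exact hX.1 _ (mul_mem (inv_mem hg) hl)
    · rw [LinearEquiv.mul_apply, P.Q_inv hg]; exact hX.2
  · rintro ⟨h1, h2⟩
    refine ⟨g⁻¹ X, ⟨fun l hl => ?_, ?_⟩, apply_inv_self _ _⟩
    · rw [← P.Q_inv hg, apply_inv_self, ← LinearEquiv.mul_apply]
      exact h1 _ (mul_mem hg hl)
    · rw [← P.Q_inv hg, apply_inv_self]; exact h2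

/-- the four vertices -/
def v4 : Fin 4 → V := ![P.A, P.r 1 P.A, P.B, P.r 0 P.B]

lemma tS_one : P.tS 1 = {X | X 2 = 1 ∧ P.a * |X 0| + P.b * |X 1| ≤ P.c} := by
  ext X
  constructor
  · rintro ⟨h1, h2⟩
    have h3 : X 2 = 1 := by
      have : Q C X = -1 := h2
      rw [Q_C] at this; linarith
    refine ⟨h3, ?_⟩
    obtain ⟨s, hs, hsX, -⟩ := P.flip_mem X
    have h4 := h1 (s⁻¹ * P.r 2) (mul_mem (inv_mem hs) (P.r_mem 2))
    rw [LinearEquiv.mul_apply, ← P.Q_inv hs, apply_inv_self, hsX, h3, r_apply, Q_rt2] at h4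
    have hc := P.c_pos
    simp [C, Q, rt] at h4
    nlinarith
  · rintro ⟨h1, h2⟩
    obtain ⟨s, hs, hsX, -⟩ := P.flip_mem X
    refine ⟨fun k hk => ?_, ?_⟩
    · have hK : P.K (s X) := by
        rw [hsX, K_iff]
        simp [h1, h2]
      have := P.main_le hK P.K_C (mul_mem hs hk)
      rw [LinearEquiv.mul_apply, P.Q_inv hs, Q_C', hsX, Q_comm] at this
      simp [h1] at this
      exact this
    · show Q C X = -1
      rw [Q_C, h1]

lemma tS_convex (g) : Convex ℝ (P.tS g) := by
  have : P.tS g = (⋂ k ∈ P.Γ, {X | Q (k C) X ≤ -1}) ∩ {X | Q (g C) X = -1} := by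
    ext X; simp [tS]
  rw [this]
  have hl : ∀ Y, IsLinearMap ℝ (Q Y) := fun Y =>
    ⟨fun _ _ => Q_add_right _ _ _, fun _ _ => Q_smul_right _ _ _⟩
  apply Convex.inter
  · exact convex_iInter₂ fun k _ => convex_halfSpace_le (hl _) _
  · exact convex_hyperplane (hl _) _

lemma tS_hull : P.tS 1 = convexHull ℝ (Set.range P.v4) := by
  have ha := P.a_pos; have hb := P.b_pos; have hc := P.c_pos
  apply Set.Subset.antisymm
  · rw [tS_one]
    rintro X ⟨h1, h2⟩
    set al := P.a * |X 0| / P.c with hal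
    set be := P.b * |X 1| / P.c with hbe
    set s := 1 - al - be with hs
    have hs0 : 0 ≤ s := by
      have : al + be ≤ 1 := by rw [hal, hbe, ← add_div]; exact (div_le_one hc).2 h2
      linarith
    set al' := P.a * X 0 / P.c with hal'
    set be' := P.b * X 1 / P.c with hbe'
    have e1 : |al'| = al := by rw [hal', hal, abs_div, abs_mul, abs_of_pos ha, abs_of_pos hc]
    have e2 : |be'| = be := by rw [hbe', hbe, abs_div, abs_mul, abs_of_pos hb, abs_of_pos hc]
    have f1 := neg_abs_le al'; have f2 := le_abs_self al'
    have f3 := neg_abs_le be'; have f4 := le_abs_self be'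
    rw [e1] at f1 f2; rw [e2] at f3 f4
    have := (convex_convexHull ℝ (Set.range P.v4)).sum_mem (t := Finset.univ)
      (w := ![(be + be') / 2 + s / 4, (be - be') / 2 + s / 4, (al + al') / 2 + s / 4,
        (al - al') / 2 + s / 4]) (z := P.v4)
      (by intro i _; fin_cases i <;> simp <;> linarith)
      (by simp [Fin.sum_univ_four]; rw [hs]; ring)
      (fun i _ => subset_convexHull _ _ ⟨i, rfl⟩)
    convert this using 1
    rw [Fin.sum_univ_four]
    ext i
    fin_cases i
    · simp [v4, A, B, r0_apply, r1_apply, hal']; field_simp; ring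
    · simp [v4, A, B, r0_apply, r1_apply, hbe']; field_simp; ring
    · simp [v4, A, B, r0_apply, r1_apply, h1, hs]; ring
  · apply convexHull_min _ (P.tS_convex 1)
    rintro _ ⟨i, rfl⟩
    have e1 : |P.a| = P.a := abs_of_pos ha
    have e2 : |P.b| = P.b := abs_of_pos hb
    have e3 : |P.c| = P.c := abs_of_pos hc
    rw [tS_one]
    fin_cases i
    · simp [v4, A, abs_div, e2, e3]; field_simp; rfl
    · simp [v4, A, r1_apply, abs_div, e2, e3]; field_simp; rfl
    · simp [v4, B, abs_div, e1, e3]; field_simp; rfl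
    · simp [v4, B, r0_apply, abs_div, e1, e3]; field_simp; rfl

end Par
end TwoOrb
end

noncomputable section
namespace TwoOrb
namespace Par
variable (P : Par)

/-- maximising set of a functional on a tile -/
def argm (g : V ≃ₗ[ℝ] V) (W : V) : Set V :=
  {X | X ∈ P.tS g ∧ ∀ Y ∈ P.tS g, Q W Y ≤ Q W X}

lemma argm_smul {g} (hg : g ∈ P.Γ) (k W) : g '' P.argm k W = P.argm (g * k) (g W) := by
  ext X
  constructor
  · rintro ⟨X, ⟨h1, h2⟩, rfl⟩
    rw [argm, ← P.tS_smul hg]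
    refine ⟨⟨X, h1, rfl⟩, ?_⟩
    rintro _ ⟨Y, hY, rfl⟩
    rw [P.Q_inv hg, P.Q_inv hg]; exact h2 Y hY
  · rw [argm, ← P.tS_smul hg]
    rintro ⟨⟨X, h1, rfl⟩, h2⟩
    refine ⟨X, ⟨h1, fun Y hY => ?_⟩, rfl⟩
    have := h2 _ ⟨Y, hY, rfl⟩
    rwa [P.Q_inv hg, P.Q_inv hg] at this

lemma tS_congr {g k : V ≃ₗ[ℝ] V} (h : g C = k C) : P.tS g = P.tS k := by
  unfold tS; rw [h]

lemma argm_congr {g k : V ≃ₗ[ℝ] V} (h : g C = k C) (W) : P.argm g W = P.argm k W := by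
  unfold argm; rw [P.tS_congr h]

/-- representative faces -/
def face : Fin 4 → Set V := ![{P.A}, {P.B}, segment ℝ P.A P.B, P.tS 1]

lemma mem_tS_one (X : V) : X ∈ P.tS 1 ↔ ∃ s t : ℝ, |s| + |t| ≤ 1 ∧
    X = ![P.c / P.a * s, P.c / P.b * t, 1] := by
  have ha := P.a_pos; have hb := P.b_pos; have hc := P.c_pos
  rw [tS_one]
  constructor
  · rintro ⟨h1, h2⟩
    refine ⟨P.a / P.c * X 0, P.b / P.c * X 1, ?_, ?_⟩
    · rw [abs_mul, abs_mul, abs_of_pos (div_pos ha hc), abs_of_pos (div_pos hb hc)]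
      have : P.a / P.c * |X 0| + P.b / P.c * |X 1| = (P.a * |X 0| + P.b * |X 1|) / P.c := by ring
      rw [this]; exact (div_le_one hc).2 h2
    · ext i; fin_cases i
      · simp; field_simp
      · simp; field_simp
      · exact h1
  · rintro ⟨s, t, h, rfl⟩
    refine ⟨rfl, ?_⟩
    show P.a * |P.c / P.a * s| + P.b * |P.c / P.b * t| ≤ P.c
    rw [abs_mul, abs_mul, abs_of_pos (div_pos hc ha), abs_of_pos (div_pos hc hb)]
    have : P.a * (P.c / P.a * |s|) + P.b * (P.c / P.b * |t|) = P.c * (|s| + |t|) := by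
      field_simp
    rw [this]; nlinarith

lemma Q_W (W : V) (s t : ℝ) : Q W ![P.c / P.a * s, P.c / P.b * t, 1] =
    (W 0 * (P.c / P.a)) * s + (W 1 * (P.c / P.b)) * t - W 2 := by
  simp [Q]; ring

lemma A_eq : P.A = ![P.c / P.a * 0, P.c / P.b * 1, 1] := by simp [A]
lemma B_eq : P.B = ![P.c / P.a * 1, P.c / P.b * 0, 1] := by simp [B]

lemma real_max {x y s t : ℝ} (hx : 0 ≤ x) (hxy : x < y) (hst : |s| + |t| ≤ 1)
    (h : y ≤ x * s + y * t) : s = 0 ∧ t = 1 := by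
  have h1 := le_abs_self s; have h2 := le_abs_self t
  have h3 := abs_nonneg s; have h4 := abs_nonneg t
  have h5 : |s| = 0 := by
    by_contra hne
    have : 0 < |s| := lt_of_le_of_ne h3 (Ne.symm hne)
    nlinarith
  have h6 := abs_eq_zero.1 h5
  subst h6
  refine ⟨rfl, ?_⟩
  have : t ≤ 1 := by linarith
  nlinarith

lemma real_le {x y s t m : ℝ} (hx : 0 ≤ x) (hy : 0 ≤ y) (hxm : x ≤ m) (hym : y ≤ m)
    (hst : |s| + |t| ≤ 1) : x * s + y * t ≤ m := by
  have h1 := le_abs_self s; have h2 := le_abs_self t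
  have h3 := abs_nonneg s; have h4 := abs_nonneg t
  nlinarith

lemma mem_seg (s t : ℝ) (hs : 0 ≤ s) (ht : 0 ≤ t) (h : s + t = 1) :
    ![P.c / P.a * s, P.c / P.b * t, 1] ∈ segment ℝ P.A P.B := by
  refine ⟨t, s, ht, hs, by linarith, ?_⟩
  ext i; fin_cases i
  · simp [A, B]; ring
  · simp [A, B]; ring
  · simp [A, B]; linarith

lemma seg_mem {X : V} (h : X ∈ segment ℝ P.A P.B) : ∃ s t : ℝ, 0 ≤ s ∧ 0 ≤ t ∧ s + t = 1 ∧
    X = ![P.c / P.a * s, P.c / P.b * t, 1] := by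
  obtain ⟨t, s, ht, hs, h, rfl⟩ := h
  refine ⟨s, t, hs, ht, by linarith, ?_⟩
  ext i; fin_cases i
  · simp [A, B]; ring
  · simp [A, B]; ring
  · simp [A, B]; linarith

lemma A_mem : P.A ∈ P.tS 1 := (P.mem_tS_one _).2 ⟨0, 1, by simp, P.A_eq⟩
lemma B_mem : P.B ∈ P.tS 1 := (P.mem_tS_one _).2 ⟨1, 0, by simp, P.B_eq⟩
lemma C_mem : C ∈ P.tS 1 := (P.mem_tS_one _).2 ⟨0, 0, by simp, by simp [C]⟩
lemma seg_sub : segment ℝ P.A P.B ⊆ P.tS 1 := (P.tS_convex 1).segment_subset P.A_mem P.B_mem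

lemma argm_A (W : V) (h0 : 0 ≤ W 0) (h : W 0 * (P.c / P.a) < W 1 * (P.c / P.b)) :
    P.argm 1 W = {P.A} := by
  have ha := P.a_pos; have hb := P.b_pos; have hc := P.c_pos
  have hx : 0 ≤ W 0 * (P.c / P.a) := by positivity
  ext X
  constructor
  · rintro ⟨h1, h2⟩
    have h3 := h2 _ P.A_mem
    obtain ⟨s, t, hst, rfl⟩ := (P.mem_tS_one _).1 h1
    rw [A_eq, Q_W, Q_W] at h3
    obtain ⟨rfl, rfl⟩ := real_max hx h hst (by linarith)
    exact P.A_eq.symm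
  · rintro rfl
    refine ⟨P.A_mem, fun Y hY => ?_⟩
    obtain ⟨s, t, hst, rfl⟩ := (P.mem_tS_one _).1 hY
    rw [A_eq, Q_W, Q_W]
    have := real_le hx (hx.trans h.le) h.le le_rfl hst
    linarith

lemma argm_B (W : V) (h0 : 0 ≤ W 1) (h : W 1 * (P.c / P.b) < W 0 * (P.c / P.a)) :
    P.argm 1 W = {P.B} := by
  have ha := P.a_pos; have hb := P.b_pos; have hc := P.c_pos
  have hx : 0 ≤ W 1 * (P.c / P.b) := by positivity
  ext X
  constructor
  · rintro ⟨h1, h2⟩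
    have h3 := h2 _ P.B_mem
    obtain ⟨s, t, hst, rfl⟩ := (P.mem_tS_one _).1 h1
    rw [B_eq, Q_W, Q_W] at h3
    obtain ⟨rfl, rfl⟩ := real_max hx h (by rwa [add_comm] at hst) (by linarith)
    exact P.B_eq.symm
  · rintro rfl
    refine ⟨P.B_mem, fun Y hY => ?_⟩
    obtain ⟨s, t, hst, rfl⟩ := (P.mem_tS_one _).1 hY
    rw [B_eq, Q_W, Q_W]
    have := real_le (hx.trans h.le) hx le_rfl h.le hst
    linarith

lemma argm_AB (W : V) (h0 : 0 < W 0 * (P.c / P.a)) (h : W 0 * (P.c / P.a) = W 1 * (P.c / P.b)) :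
    P.argm 1 W = segment ℝ P.A P.B := by
  ext X
  constructor
  · rintro ⟨h1, h2⟩
    have h3 := h2 _ P.A_mem
    obtain ⟨s, t, hst, rfl⟩ := (P.mem_tS_one _).1 h1
    rw [A_eq, Q_W, Q_W, ← h] at h3
    have e1 := le_abs_self s; have e2 := le_abs_self t
    have e3 := abs_nonneg s; have e4 := abs_nonneg t
    have h4 : 1 ≤ s + t := by nlinarith
    have e5 : |s| = s := by linarith
    have e6 : |t| = t := by linarith
    exact P.mem_seg s t (by linarith) (by linarith) (by linarith)
  · intro hX
    refine ⟨P.seg_sub hX, fun Y hY => ?_⟩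
    obtain ⟨s, t, hs, ht, hst, rfl⟩ := P.seg_mem hX
    obtain ⟨s', t', hst', rfl⟩ := (P.mem_tS_one _).1 hY
    rw [Q_W, Q_W, ← h]
    have := real_le h0.le h0.le le_rfl le_rfl hst'
    nlinarith

lemma argm_all (W : V) (h0 : W 0 = 0) (h1 : W 1 = 0) : P.argm 1 W = P.tS 1 := by
  ext X
  refine ⟨fun h => h.1, fun h => ⟨h, fun Y hY => ?_⟩⟩
  obtain ⟨s, t, hst, rfl⟩ := (P.mem_tS_one _).1 h
  obtain ⟨s', t', hst', rfl⟩ := (P.mem_tS_one _).1 hY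
  rw [Q_W, Q_W, h0, h1]; linarith

lemma argm_face (W : V) (h0 : 0 ≤ W 0) (h1 : 0 ≤ W 1) : ∃ i, P.argm 1 W = P.face i := by
  have ha := P.a_pos; have hb := P.b_pos; have hc := P.c_pos
  rcases lt_trichotomy (W 0 * (P.c / P.a)) (W 1 * (P.c / P.b)) with h | h | h
  · exact ⟨0, P.argm_A W h0 h⟩
  · rcases h0.lt_or_eq with h0 | h0
    · exact ⟨2, P.argm_AB W (by positivity) h⟩
    · refine ⟨3, P.argm_all W h0.symm ?_⟩
      rw [← h0, zero_mul] at h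
      have : P.c / P.b ≠ 0 := by positivity
      exact (mul_eq_zero.1 h.symm).resolve_right this
  · exact ⟨1, P.argm_B W h1 h⟩

lemma face_argm (i : Fin 4) : ∃ W, P.face i = P.argm 1 W := by
  have ha := P.a_pos; have hb := P.b_pos; have hc := P.c_pos
  fin_cases i
  · exact ⟨![0, 1, 0], (P.argm_A _ (by simp) (by simp; positivity)).symm⟩
  · exact ⟨![1, 0, 0], (P.argm_B _ (by simp) (by simp; positivity)).symm⟩
  · exact ⟨![P.a, P.b, 0], (P.argm_AB _ (by simp; positivity) (by simp; field_simp)).symm⟩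
  · exact ⟨0, (P.argm_all _ (by simp) (by simp)).symm⟩

lemma flip_C {s : V ≃ₗ[ℝ] V} (hs : s = 1 ∨ s = P.r 0 ∨ s = P.r 1 ∨ s = P.r 0 * P.r 1) :
    s C = C := by
  rcases hs with rfl | rfl | rfl | rfl
  · rfl
  · rw [r0_apply]; simp [C]
  · rw [r1_apply]; simp [C]
  · rw [LinearEquiv.mul_apply, r1_apply, r0_apply]; simp [C]

lemma argm_class {g} (hg : g ∈ P.Γ) (W : V) : ∃ k ∈ P.Γ, ∃ i, P.argm g W = k '' P.face i := by
  obtain ⟨s, hs, hsW, hs'⟩ := P.flip_mem (g⁻¹ W)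
  obtain ⟨i, hi⟩ := P.argm_face (s (g⁻¹ W)) (by rw [hsW]; simp) (by rw [hsW]; simp)
  refine ⟨g * s⁻¹, mul_mem hg (inv_mem hs), i, ?_⟩
  rw [← hi, P.argm_smul (mul_mem hg (inv_mem hs))]
  have e : (g * s⁻¹) (s (g⁻¹ W)) = W := by
    rw [LinearEquiv.mul_apply, inv_apply_self, apply_inv_self]
  rw [e]
  apply P.argm_congr
  rw [mul_one, LinearEquiv.mul_apply]
  congr 1
  conv_rhs => rw [← P.flip_C hs', inv_apply_self]

end Par
end TwoOrb
end

noncomputable section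
namespace TwoOrb

/-- vertical projection -/
def pr : V →ₗ[ℝ] EucSp 2 where
  toFun X := !₂[X 0, X 1]
  map_add' X Y := by ext i; fin_cases i <;> simp
  map_smul' k X := by ext i; fin_cases i <;> simp

@[simp] lemma pr_zero (X : V) : pr X 0 = X 0 := rfl
@[simp] lemma pr_one (X : V) : pr X 1 = X 1 := rfl

namespace Par
variable (P : Par)

/-- lift to the surface -/
def L (x : EucSp 2) : V := ![x 0, x 1, (P.S_exists (x 0) (x 1)).choose]

lemma L_mem (x) : P.L x ∈ P.S := (P.S_exists (x 0) (x 1)).choose_spec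
@[simp] lemma L_zero (x) : P.L x 0 = x 0 := rfl
@[simp] lemma L_one (x) : P.L x 1 = x 1 := rfl
lemma pr_L (x) : pr (P.L x) = x := by ext i; fin_cases i <;> rfl
lemma L_pr {X : V} (hX : X ∈ P.S) : P.L (pr X) = X := P.S_unique (P.L_mem _) hX rfl rfl
lemma L_inj : Function.Injective P.L := fun x y h => by rw [← P.pr_L x, h, P.pr_L]

/-- planar tile -/
def tile (g : V ≃ₗ[ℝ] V) : Set (EucSp 2) := {x | P.L x ∈ P.tS g}

/-- the tiling -/
def T : Set (Set (EucSp 2)) := {t | ∃ g ∈ P.Γ, t = P.tile g}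

lemma image_L_pr {D : Set V} (hD : D ⊆ P.S) : P.L '' (pr '' D) = D := by
  ext X
  constructor
  · rintro ⟨_, ⟨Y, hY, rfl⟩, rfl⟩
    rw [P.L_pr (hD hY)]; exact hY
  · intro hX
    exact ⟨_, ⟨X, hX, rfl⟩, P.L_pr (hD hX)⟩

lemma image_pr_L (F : Set (EucSp 2)) : pr '' (P.L '' F) = F := by
  ext x
  constructor
  · rintro ⟨_, ⟨y, hy, rfl⟩, rfl⟩
    rw [P.pr_L]; exact hy
  · intro hx
    exact ⟨_, ⟨x, hx, rfl⟩, P.pr_L x⟩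

lemma tile_eq {g} (hg : g ∈ P.Γ) : P.tile g = pr '' P.tS g := by
  ext x
  constructor
  · intro h; exact ⟨_, h, P.pr_L x⟩
  · rintro ⟨X, hX, rfl⟩
    show P.L (pr X) ∈ P.tS g
    rw [P.L_pr (P.tS_sub hg hX)]; exact hX

lemma L_tile {g} (hg : g ∈ P.Γ) : P.L '' P.tile g = P.tS g := by
  rw [P.tile_eq hg, P.image_L_pr (P.tS_sub hg)]

lemma argm_sub {g} (hg : g ∈ P.Γ) (W) : P.argm g W ⊆ P.S := fun _ h => P.tS_sub hg h.1

/-- exposing functional on a tile -/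
lemma exposed_of_argm {g} (hg : g ∈ P.Γ) (W : V) : IsExposed ℝ (P.tile g) (pr '' P.argm g W) := by
  intro _
  have hw := (P.fwd_g hg fwd_C).1
  set Y := g C with hY
  refine ⟨(W 0 - W 2 * Y 0 / Y 2) • EuclideanSpace.proj 0 +
    (W 1 - W 2 * Y 1 / Y 2) • EuclideanSpace.proj 1, ?_⟩
  have key : ∀ x ∈ P.tile g, ((W 0 - W 2 * Y 0 / Y 2) • (EuclideanSpace.proj 0 : EucSp 2 →L[ℝ] ℝ) +
    (W 1 - W 2 * Y 1 / Y 2) • (EuclideanSpace.proj 1 : EucSp 2 →L[ℝ] ℝ)) x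
      = Q W (P.L x) + W 2 / Y 2 := by
    intro x hx
    have h1 : Q Y (P.L x) = -1 := hx.2
    have h2 : P.L x 2 = (1 + Y 0 * x 0 + Y 1 * x 1) / Y 2 := by
      rw [eq_div_iff hw.ne']
      simp only [Q, L_zero, L_one] at h1
      linarith
    simp only [Q, h2, L_zero, L_one]
    simp
    field_simp
    ring
  ext x
  constructor
  · rintro ⟨X, ⟨h1, h2⟩, rfl⟩
    have hX := P.L_pr (P.tS_sub hg h1)
    have hx : pr X ∈ P.tile g := by show P.L (pr X) ∈ P.tS g; rw [hX]; exact h1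
    refine ⟨hx, fun y hy => ?_⟩
    rw [key _ hy, key _ hx, hX]
    have := h2 _ hy
    linarith
  · rintro ⟨h1, h2⟩
    refine ⟨P.L x, ⟨h1, fun Z hZ => ?_⟩, P.pr_L x⟩
    have hZ' := P.L_pr (P.tS_sub hg hZ)
    have hz : pr Z ∈ P.tile g := by show P.L (pr Z) ∈ P.tS g; rw [hZ']; exact hZ
    have := h2 _ hz
    rw [key _ hz, key _ h1, hZ'] at this
    linarith

lemma argm_of_exposed {g} (hg : g ∈ P.Γ) {F : Set (EucSp 2)} (h : IsExposed ℝ (P.tile g) F)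
    (hF : F.Nonempty) : ∃ W, P.L '' F = P.argm g W := by
  obtain ⟨l, rfl⟩ := h hF
  have key : ∀ x, l x = Q ![l (EuclideanSpace.single 0 1), l (EuclideanSpace.single 1 1), 0] (P.L x) := by
    intro x
    have : x = x 0 • EuclideanSpace.single 0 (1 : ℝ) + x 1 • EuclideanSpace.single 1 (1 : ℝ) := by
      ext i; fin_cases i <;> simp
    conv_lhs => rw [this]
    rw [map_add, map_smul, map_smul]
    simp [Q]
    ring
  refine ⟨![l (EuclideanSpace.single 0 1), l (EuclideanSpace.single 1 1), 0], ?_⟩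
  ext X
  constructor
  · rintro ⟨x, ⟨h1, h2⟩, rfl⟩
    refine ⟨h1, fun Y hY => ?_⟩
    rw [← P.L_tile hg] at hY
    obtain ⟨y, hy, rfl⟩ := hY
    rw [← key, ← key]; exact h2 y hy
  · rintro ⟨h1, h2⟩
    rw [← P.L_tile hg] at h1
    obtain ⟨x, hx, rfl⟩ := h1
    refine ⟨x, ⟨hx, fun y hy => ?_⟩, rfl⟩
    rw [key y, key x]; exact h2 _ hy

lemma tS_inter {g k} (hk : k ∈ P.Γ) (h : (P.tS g ∩ P.tS k).Nonempty) :
    P.tS g ∩ P.tS k = P.argm g (k C) := by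
  obtain ⟨Z, hZg, hZk⟩ := h
  ext X
  constructor
  · rintro ⟨h1, h2⟩
    refine ⟨h1, fun Y hY => ?_⟩
    rw [h2.2]; exact hY.1 k hk
  · rintro ⟨h1, h2⟩
    refine ⟨h1, h1.1, le_antisymm (h1.1 k hk) ?_⟩
    have := h2 Z hZg
    rwa [hZk.2] at this

lemma ftf {g k} (hg : g ∈ P.Γ) (hk : k ∈ P.Γ) :
    IsExposed ℝ (P.tile g) (P.tile g ∩ P.tile k) := by
  intro hne
  have e : P.tile g ∩ P.tile k = pr '' (P.tS g ∩ P.tS k) := by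
    ext x
    constructor
    · rintro h; exact ⟨P.L x, h, P.pr_L x⟩
    · rintro ⟨X, hX, rfl⟩
      have := P.L_pr (P.tS_sub hg hX.1)
      show P.L (pr X) ∈ P.tS g ∧ P.L (pr X) ∈ P.tS k
      rw [this]; exact hX
  rw [e] at hne ⊢
  have hne2 := Set.image_nonempty.1 hne
  rw [P.tS_inter hk hne2] at hne ⊢
  exact P.exposed_of_argm hg _ hne

lemma tile_poly {g} (hg : g ∈ P.Γ) : IsConvexPolytope (P.tile g) := by
  constructor
  · refine ⟨Finset.univ.image fun i => pr (g (P.v4 i)), ?_⟩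
    have : P.tS g = g '' P.tS 1 := by rw [P.tS_smul hg, mul_one]
    rw [P.tile_eq hg, this, tS_hull, Set.image_image]
    have e := LinearMap.image_convexHull (pr ∘ₗ g.toLinearMap) (Set.range P.v4)
    simp only [LinearMap.coe_comp] at e
    rw [← Set.range_comp] at e
    simpa [Function.comp_def] using e
  · have hw := (P.fwd_g hg fwd_C).1
    set Y := g C with hY
    set u : EucSp 2 → V := fun x => ![x 0, x 1, (1 + Y 0 * x 0 + Y 1 * x 1) / Y 2] with hu
    have hu1 : ∀ x, Q Y (u x) = -1 := by
      intro x
      simp [hu, Q]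
      field_simp
      ring
    have hcu : Continuous u := by
      apply continuous_pi
      intro i
      fin_cases i <;> simp [hu] <;> fun_prop
    have hcg : Continuous fun x => g⁻¹ (u x) :=
      (LinearMap.continuous_of_finiteDimensional (g⁻¹ : V ≃ₗ[ℝ] V).toLinearMap).comp hcu
    have hc0 : ∀ i, Continuous fun x => (g⁻¹ (u x)) i := fun i => (continuous_apply i).comp hcg
    have hop : IsOpen {x | P.a * |(g⁻¹ (u x)) 0| + P.b * |(g⁻¹ (u x)) 1| < P.c} := by
      apply isOpen_lt _ continuous_const
      exact (continuous_const.mul (hc0 0).abs).add (continuous_const.mul (hc0 1).abs)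
    refine ⟨pr Y, mem_interior.2 ⟨_, ?_, hop, ?_⟩⟩
    · intro x hx
      have h1 : g⁻¹ (u x) ∈ P.tS 1 := by
        rw [tS_one]
        refine ⟨?_, le_of_lt hx⟩
        have := P.Q_inv hg C (g⁻¹ (u x))
        rw [apply_inv_self, ← hY, hu1, Q_C] at this
        linarith
      have h2 : u x ∈ P.tS g := by
        have : u x ∈ g '' P.tS 1 := ⟨_, h1, apply_inv_self _ _⟩
        rwa [P.tS_smul hg, mul_one] at this
      rw [P.tile_eq hg]
      refine ⟨_, h2, ?_⟩
      ext i; fin_cases i <;> rfl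
    · have e : u (pr Y) = Y := by
        have h : Q Y Y = -1 := by rw [hY, P.Q_inv hg, Q_C]; rfl
        ext i; fin_cases i
        · rfl
        · rfl
        · show (1 + Y 0 * Y 0 + Y 1 * Y 1) / Y 2 = Y 2
          rw [div_eq_iff hw.ne']
          simp only [Q] at h; linarith
      show P.a * |(g⁻¹ (u (pr Y))) 0| + P.b * |(g⁻¹ (u (pr Y))) 1| < P.c
      rw [e, hY, inv_apply_self]
      simp [C, P.c_pos]

lemma isLFC : IsLFCTiling P.T where
  polytope := by
    rintro _ ⟨g, hg, rfl⟩; exact P.tile_poly hg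
  covers := by
    ext x
    simp only [Set.mem_univ, iff_true]
    obtain ⟨h1, g, hg, h2⟩ := P.L_mem x
    exact ⟨_, ⟨g, hg, rfl⟩, h1, h2⟩
  face_to_face := by
    rintro _ ⟨g, hg, rfl⟩ _ ⟨k, hk, rfl⟩
    refine ⟨P.ftf hg hk, ?_⟩
    rw [Set.inter_comm]; exact P.ftf hk hg
  locally_finite := by
    intro B hB
    obtain ⟨R, hR⟩ := hB.exists_norm_le
    apply ((P.loc_fin R).image P.tile).subset
    rintro _ ⟨⟨g, hg, rfl⟩, x, hx, hxB⟩
    refine ⟨g, ⟨hg, P.L x, hx, ?_⟩, rfl⟩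
    have := hR x hxB
    rw [EuclideanSpace.norm_eq, Fin.sum_univ_two] at this
    simpa [rad] using this

/-- the model poset -/
def UP : Type := {D : Set V // D = ∅ ∨ D = Set.univ ∨ ∃ g ∈ P.Γ, ∃ i, D = g '' P.face i}

instance : PartialOrder P.UP := Subtype.partialOrder _

lemma face_sub (i : Fin 4) : P.face i ⊆ P.tS 1 := by
  fin_cases i
  · exact Set.singleton_subset_iff.2 P.A_mem
  · exact Set.singleton_subset_iff.2 P.B_mem
  · exact P.seg_sub
  · exact subset_rfl

lemma face_S {g} (hg : g ∈ P.Γ) (i : Fin 4) : g '' P.face i ⊆ P.S := by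
  rintro _ ⟨X, hX, rfl⟩
  exact P.S_smul hg (P.tS_sub (one_mem _) (P.face_sub i hX))

lemma zero_not_S : (0 : V) ∉ P.S := by
  rintro ⟨h, -⟩
  have := h 1 (one_mem _)
  simp [Q] at this
  linarith

/-- comparison map -/
def toUP : TPoset P.T → P.UP :=
  WithTop.recTopCoe ⟨Set.univ, Or.inr (Or.inl rfl)⟩ (fun F => ⟨P.L '' F.1, by
    obtain ⟨F, _, ⟨g, hg, rfl⟩, hF⟩ := F
    rcases F.eq_empty_or_nonempty with h | h
    · left; simp [h]
    · right; right
      obtain ⟨W, hW⟩ := P.argm_of_exposed hg hF h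
      obtain ⟨k, hk, i, h⟩ := P.argm_class hg W
      exact ⟨k, hk, i, hW.trans h⟩⟩)

lemma toUP_le (x y : TPoset P.T) : P.toUP x ≤ P.toUP y ↔ x ≤ y := by
  induction y using WithTop.recTopCoe with
  | top => simp only [le_top, iff_true]; exact Set.subset_univ _
  | coe G =>
    induction x using WithTop.recTopCoe with
    | top =>
      simp only [top_le_iff, WithTop.coe_ne_top, iff_false]
      intro h
      have : (0 : V) ∈ P.L '' G.1 := h (Set.mem_univ _)
      obtain ⟨x, -, hx⟩ := this
      exact P.zero_not_S (hx ▸ P.L_mem x)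
    | coe F =>
      rw [WithTop.coe_le_coe]
      show P.L '' F.1 ⊆ P.L '' G.1 ↔ F.1 ⊆ G.1
      exact Set.image_subset_image_iff P.L_inj

lemma toUP_surj : Function.Surjective P.toUP := by
  rintro ⟨D, rfl | rfl | ⟨g, hg, i, rfl⟩⟩
  · refine ⟨WithTop.some (⟨∅, P.tile 1, ⟨1, one_mem _, rfl⟩, ?_⟩ : TFace P.T), ?_⟩
    · rintro ⟨x, hx⟩; exact hx.elim
    · apply Subtype.ext
      show P.L '' ∅ = ∅
      simp
  · exact ⟨⊤, rfl⟩
  · obtain ⟨W, hW⟩ := P.face_argm i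
    refine ⟨WithTop.some (⟨pr '' (g '' P.face i), P.tile g, ⟨g, hg, rfl⟩, ?_⟩ : TFace P.T), ?_⟩
    · rw [hW, P.argm_smul hg, mul_one]
      exact P.exposed_of_argm hg _
    · apply Subtype.ext
      exact P.image_L_pr (P.face_S hg i)

/-- the face poset is the model poset -/
def isoUP : TPoset P.T ≃o P.UP :=
  RelIso.ofSurjective (OrderEmbedding.ofMapLEIff P.toUP P.toUP_le) P.toUP_surj

end Par
end TwoOrb
end

noncomputable section
namespace TwoOrb

section generic
universe u v

/-- A ranked bounded poset of height four. -/
structure Rk (O : Type u) [PartialOrder O] (ρ : O → ℕ) (b t : O) : Prop where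
  mono : ∀ x y, x < y → ρ x < ρ y
  gap : ∀ x y, x < y → ρ x + 2 ≤ ρ y → ∃ z, x < z ∧ z < y
  bot : ∀ x, b ≤ x
  top : ∀ x, x ≤ t
  rb : ρ b = 0
  rt : ρ t = 4

/-- order theoretic atoms -/
def At {O : Type u} [PartialOrder O] (x : O) : Prop := ¬ IsMin x ∧ ∀ y, y < x → IsMin y
/-- order theoretic coatoms -/
def CoAt {O : Type u} [PartialOrder O] (x : O) : Prop := ¬ IsMax x ∧ ∀ y, x < y → IsMax y
/-- number of coatoms above an element -/
def deg {O : Type u} [PartialOrder O] (x : O) : ℕ := {t | x ≤ t ∧ CoAt t}.ncard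

variable {O : Type u} [PartialOrder O] {O' : Type v} [PartialOrder O']

lemma At.map {x : O} (h : At x) (e : O ≃o O') : At (e x) := by
  refine ⟨fun hm => h.1 ?_, fun y hy => ?_⟩
  · intro z hz
    have := hm (e.monotone hz)
    exact e.le_iff_le.1 this
  · have h1 : e.symm y < x := by
      have := e.symm.strictMono hy
      rwa [e.symm_apply_apply] at this
    have h2 := h.2 _ h1
    intro z hz
    have h3 := h2 (e.symm.monotone hz)
    exact e.symm.le_iff_le.1 h3

lemma CoAt.map {x : O} (h : CoAt x) (e : O ≃o O') : CoAt (e x) := by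
  refine ⟨fun hm => h.1 ?_, fun y hy => ?_⟩
  · intro z hz
    have := hm (e.monotone hz)
    exact e.le_iff_le.1 this
  · have h1 : x < e.symm y := by
      have := e.symm.strictMono hy
      rwa [e.symm_apply_apply] at this
    have h2 := h.2 _ h1
    intro z hz
    have h3 := h2 (e.symm.monotone hz)
    exact e.symm.le_iff_le.1 h3

lemma deg_map (x : O) (e : O ≃o O') : deg (e x) = deg x := by
  unfold deg
  rw [← Set.ncard_image_of_injective {t | x ≤ t ∧ CoAt t} e.injective]
  congr 1
  ext t
  constructor
  · rintro ⟨h1, h2⟩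
    refine ⟨e.symm t, ⟨?_, h2.map e.symm⟩, e.apply_symm_apply t⟩
    rw [← e.le_iff_le, e.apply_symm_apply]; exact h1
  · rintro ⟨t, ⟨h1, h2⟩, rfl⟩
    exact ⟨e.monotone h1, h2.map e⟩

namespace Rk
variable {ρ : O → ℕ} {b t : O}

lemma le_four (H : Rk O ρ b t) (x : O) : ρ x ≤ 4 := by
  rcases (H.top x).lt_or_eq with h | h
  · have := H.mono _ _ h; rw [H.rt] at this; omega
  · rw [h, H.rt]

lemma eq_bot (H : Rk O ρ b t) {x : O} (h : ρ x = 0) : x = b := by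
  rcases (H.bot x).lt_or_eq with h' | h'
  · have := H.mono _ _ h'; omega
  · exact h'.symm

lemma eq_top (H : Rk O ρ b t) {x : O} (h : ρ x = 4) : x = t := by
  rcases (H.top x).lt_or_eq with h' | h'
  · have := H.mono _ _ h'; rw [H.rt] at this; omega
  · exact h'

lemma at_iff (H : Rk O ρ b t) (x : O) : At x ↔ ρ x = 1 := by
  have hb : IsMin b := fun y _ => H.bot y
  constructor
  · rintro ⟨h1, h2⟩
    by_contra hne
    have h0 : ρ x ≠ 0 := fun h => h1 (H.eq_bot h ▸ hb)
    have hlt : b < x := lt_of_le_of_ne (H.bot x) (by rintro rfl; exact h0 H.rb)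
    obtain ⟨z, hz1, hz2⟩ := H.gap _ _ hlt (by rw [H.rb]; omega)
    exact (h2 z hz2).not_lt hz1
  · intro h
    have hlt : b < x := lt_of_le_of_ne (H.bot x) (by rintro rfl; rw [H.rb] at h; omega)
    refine ⟨fun hm => hm.not_lt hlt, fun y hy => ?_⟩
    have := H.mono _ _ hy
    rw [H.eq_bot (x := y) (by omega)]; exact hb

lemma coat_iff (H : Rk O ρ b t) (x : O) : CoAt x ↔ ρ x = 3 := by
  have hb : IsMax t := fun y _ => H.top y
  constructor
  · rintro ⟨h1, h2⟩
    by_contra hne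
    have h0 : ρ x ≠ 4 := fun h => h1 (H.eq_top h ▸ hb)
    have hlt : x < t := lt_of_le_of_ne (H.top x) (by rintro rfl; exact h0 H.rt)
    have := H.le_four x
    obtain ⟨z, hz1, hz2⟩ := H.gap _ _ hlt (by rw [H.rt]; omega)
    exact (h2 z hz1).not_lt hz2
  · intro h
    have hlt : x < t := lt_of_le_of_ne (H.top x) (by rintro rfl; rw [H.rt] at h; omega)
    refine ⟨fun hm => hm.not_lt hlt, fun y hy => ?_⟩
    have := H.mono _ _ hy
    have := H.le_four y
    rw [H.eq_top (x := y) (by omega)]; exact hb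

lemma flag_le (H : Rk O ρ b t) {Ω : Flag O} {x y : O} (hx : x ∈ Ω) (hy : y ∈ Ω) (h : ρ x ≤ ρ y) : x ≤ y := by
  rcases Ω.le_or_le hx hy with h' | h'
  · exact h'
  · rcases h'.lt_or_eq with h' | h'
    · have := H.mono _ _ h'; omega
    · exact h'.symm.le

lemma flag_unique (H : Rk O ρ b t) {Ω : Flag O} {x y : O} (hx : x ∈ Ω) (hy : y ∈ Ω) (h : ρ x = ρ y) : x = y :=
  le_antisymm (H.flag_le hx hy h.le) (H.flag_le hy hx h.ge)

lemma bot_mem (H : Rk O ρ b t) (Ω : Flag O) : b ∈ Ω :=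
  Flag.mem_iff_forall_le_or_ge.2 fun _ _ => Or.inl (H.bot _)
lemma top_mem (H : Rk O ρ b t) (Ω : Flag O) : t ∈ Ω :=
  Flag.mem_iff_forall_le_or_ge.2 fun _ _ => Or.inr (H.top _)

lemma flag_exists (H : Rk O ρ b t) (Ω : Flag O) {i : ℕ} (hi : i ≤ 4) : ∃ x ∈ Ω, ρ x = i := by
  by_contra hcon
  push Not at hcon
  obtain ⟨m, ⟨x, hx, hxi, rfl⟩, hmax⟩ : ∃ m, (∃ x ∈ Ω, ρ x ≤ i ∧ ρ x = m) ∧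
      ∀ y ∈ Ω, ρ y ≤ i → ρ y ≤ m := by
    have hne : {m | ∃ x ∈ Ω, ρ x ≤ i ∧ ρ x = m}.Nonempty :=
      ⟨0, b, H.bot_mem Ω, by rw [H.rb]; omega, H.rb⟩
    have hfin : {m | ∃ x ∈ Ω, ρ x ≤ i ∧ ρ x = m}.Finite := by
      apply (Set.finite_Iic i).subset
      rintro _ ⟨x, -, h, rfl⟩; exact h
    obtain ⟨m, hm, hmm⟩ := Set.exists_max_image _ id hfin hne
    exact ⟨m, hm, fun y hy hyi => hmm _ ⟨y, hy, hyi, rfl⟩⟩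
  obtain ⟨m, ⟨y, hy, hyi, rfl⟩, hmin⟩ : ∃ m, (∃ x ∈ Ω, i ≤ ρ x ∧ ρ x = m) ∧
      ∀ y ∈ Ω, i ≤ ρ y → m ≤ ρ y := by
    have hne : {m | ∃ x ∈ Ω, i ≤ ρ x ∧ ρ x = m}.Nonempty :=
      ⟨4, t, H.top_mem Ω, by rw [H.rt]; omega, H.rt⟩
    have hfin : {m | ∃ x ∈ Ω, i ≤ ρ x ∧ ρ x = m}.Finite := by
      apply (Set.finite_Iic 4).subset
      rintro _ ⟨x, -, h, rfl⟩; exact H.le_four x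
    obtain ⟨m, hm, hmm⟩ := Set.exists_min_image _ id hfin hne
    exact ⟨m, hm, fun y hy hyi => hmm _ ⟨y, hy, hyi, rfl⟩⟩
  have h1 := hcon x hx
  have h2 := hcon y hy
  have hxy : x < y := lt_of_le_of_ne (H.flag_le hx hy (by omega)) (by rintro rfl; omega)
  obtain ⟨z, hz1, hz2⟩ := H.gap x y hxy (by omega)
  have hz : z ∈ Ω := Flag.mem_iff_forall_le_or_ge.2 fun w hw => by
    rcases le_total (ρ w) i with h | h
    · right; exact (H.flag_le hw hx (hmax w hw h)).trans hz1.le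
    · left; exact hz2.le.trans (H.flag_le hy hw (hmin w hw h))
  have h3 := H.mono _ _ hz1
  have h4 := H.mono _ _ hz2
  rcases le_total (ρ z) i with h | h
  · have := hmax z hz h; omega
  · have := hmin z hz h; omega

lemma flag_ext (H : Rk O ρ b t) {Ω Ψ : Flag O} {y1 y2 y3 : O} (r1 : ρ y1 = 1) (r2 : ρ y2 = 2) (r3 : ρ y3 = 3)
    (h1 : y1 ∈ Ω) (h2 : y2 ∈ Ω) (h3 : y3 ∈ Ω) (k1 : y1 ∈ Ψ) (k2 : y2 ∈ Ψ) (k3 : y3 ∈ Ψ) :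
    Ω = Ψ := by
  have key : ∀ Ω Ψ : Flag O, y1 ∈ Ω → y2 ∈ Ω → y3 ∈ Ω → y1 ∈ Ψ → y2 ∈ Ψ → y3 ∈ Ψ →
      ∀ x ∈ Ω, x ∈ Ψ := by
    intro Ω Ψ h1 h2 h3 k1 k2 k3 x hx
    have := H.le_four x
    obtain h | h | h | h | h : ρ x = 0 ∨ ρ x = 1 ∨ ρ x = 2 ∨ ρ x = 3 ∨ ρ x = 4 := by omega
    · rw [H.eq_bot h]; exact H.bot_mem _
    · rw [H.flag_unique hx h1 (by omega)]; exact k1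
    · rw [H.flag_unique hx h2 (by omega)]; exact k2
    · rw [H.flag_unique hx h3 (by omega)]; exact k3
    · rw [H.eq_top h]; exact H.top_mem _
  apply SetLike.ext
  exact fun x => ⟨key Ω Ψ h1 h2 h3 k1 k2 k3 x, key Ψ Ω k1 k2 k3 h1 h2 h3 x⟩

lemma flag_of (H : Rk O ρ b t) {y1 y2 y3 : O} (h12 : y1 ≤ y2) (h23 : y2 ≤ y3) :
    ∃ Ω : Flag O, y1 ∈ Ω ∧ y2 ∈ Ω ∧ y3 ∈ Ω := by
  have hc : IsChain (· ≤ ·) ({y1, y2, y3} : Set O) := by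
    intro x hx y hy _
    simp only [Set.mem_insert_iff, Set.mem_singleton_iff] at hx hy
    rcases hx with rfl | rfl | rfl <;> rcases hy with rfl | rfl | rfl <;>
      first
        | exact Or.inl le_rfl
        | exact Or.inl h12
        | exact Or.inl h23
        | exact Or.inl (h12.trans h23)
        | exact Or.inr h12
        | exact Or.inr h23
        | exact Or.inr (h12.trans h23)
  obtain ⟨Ω, hΩ⟩ := hc.exists_subset_flag
  exact ⟨Ω, hΩ (by simp), hΩ (by simp), hΩ (by simp)⟩

/-- abstract two-orbit criterion -/
lemma two_orbits (H : Rk O ρ b t) {a1 a1' a2 a3 : O} (r1 : ρ a1 = 1) (r1' : ρ a1' = 1) (r2 : ρ a2 = 2)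
    (r3 : ρ a3 = 3) (h1 : a1 ≤ a2) (h1' : a1' ≤ a2) (h2 : a2 ≤ a3) (hd : deg a1 ≠ deg a1')
    (htr : ∀ x1 x2 x3, ρ x1 = 1 → ρ x2 = 2 → ρ x3 = 3 → x1 ≤ x2 → x2 ≤ x3 →
      ∃ γ : O ≃o O, (γ x1 = a1 ∨ γ x1 = a1') ∧ γ x2 = a2 ∧ γ x3 = a3) : TwoFlagOrbits O := by
  obtain ⟨Φ, p1, p2, p3⟩ := H.flag_of h1 h2
  obtain ⟨Ψ, q1, q2, q3⟩ := H.flag_of h1' h2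
  refine ⟨Φ, Ψ, ?_, fun Ω => ?_⟩
  · rintro ⟨γ, hγ⟩
    have hm : γ a1 ∈ Ψ := by
      have : γ a1 ∈ γ '' (Φ : Set O) := ⟨a1, p1, rfl⟩
      rw [hγ] at this; exact this
    have hr : ρ (γ a1) = 1 := (H.at_iff _).1 (((H.at_iff _).2 r1).map γ)
    have := H.flag_unique hm q1 (by rw [hr, r1'])
    apply hd
    rw [← this, deg_map]
  · obtain ⟨x1, m1, s1⟩ := H.flag_exists Ω (i := 1) (by omega)
    obtain ⟨x2, m2, s2⟩ := H.flag_exists Ω (i := 2) (by omega)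
    obtain ⟨x3, m3, s3⟩ := H.flag_exists Ω (i := 3) (by omega)
    obtain ⟨γ, g1, g2, g3⟩ := htr x1 x2 x3 s1 s2 s3 (H.flag_le m1 m2 (by omega))
      (H.flag_le m2 m3 (by omega))
    have n1 : γ x1 ∈ Flag.map γ Ω := ⟨x1, m1, rfl⟩
    have n2 : γ x2 ∈ Flag.map γ Ω := ⟨x2, m2, rfl⟩
    have n3 : γ x3 ∈ Flag.map γ Ω := ⟨x3, m3, rfl⟩
    rw [g2] at n2; rw [g3] at n3
    rcases g1 with g1 | g1
    · left
      rw [g1] at n1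
      exact ⟨γ, by rw [← H.flag_ext r1 r2 r3 n1 n2 n3 p1 p2 p3]; rfl⟩
    · right
      rw [g1] at n1
      exact ⟨γ, by rw [← H.flag_ext r1' r2 r3 n1 n2 n3 q1 q2 q3]; rfl⟩

end Rk

lemma TwoFlagOrbits.map (e : O ≃o O') (h : TwoFlagOrbits O) : TwoFlagOrbits O' := by
  obtain ⟨Φ, Ψ, h1, h2⟩ := h
  have key : ∀ (f : O ≃o O') (A B : Flag O), SameFlagOrbit A B →
      SameFlagOrbit (Flag.map f A) (Flag.map f B) := by
    rintro f A B ⟨γ, hγ⟩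
    refine ⟨(f.symm.trans γ).trans f, ?_⟩
    rw [Flag.coe_map, Flag.coe_map, ← hγ, Set.image_image, Set.image_image]
    simp
  have key2 : ∀ (f : O' ≃o O) (A B : Flag O'), SameFlagOrbit A B →
      SameFlagOrbit (Flag.map f A) (Flag.map f B) := by
    rintro f A B ⟨γ, hγ⟩
    refine ⟨(f.symm.trans γ).trans f, ?_⟩
    rw [Flag.coe_map, Flag.coe_map, ← hγ, Set.image_image, Set.image_image]
    simp
  have back : ∀ A : Flag O, Flag.map e.symm (Flag.map e A) = A := by
    intro A; apply SetLike.coe_injective; simp [Set.image_image]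
  have forth : ∀ A : Flag O', Flag.map e (Flag.map e.symm A) = A := by
    intro A; apply SetLike.coe_injective; simp [Set.image_image]
  refine ⟨Flag.map e Φ, Flag.map e Ψ, fun h => h1 ?_, fun Ω => ?_⟩
  · have := key2 e.symm _ _ h
    rwa [back, back] at this
  · rcases h2 (Flag.map e.symm Ω) with h | h
    · left; have := key e _ _ h; rwa [forth] at this
    · right; have := key e _ _ h; rwa [forth] at this

end generic
end TwoOrb
end

noncomputable section
namespace TwoOrb
namespace Par
variable (P : Par)

lemma A_two : P.A 2 = 1 := rfl
lemma B_two : P.B 2 = 1 := rfl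

lemma two_of_tS {X : V} (h : X ∈ P.tS 1) : X 2 = 1 := by rw [tS_one] at h; exact h.1

lemma ext3 {X Y : V} (h0 : X 0 = Y 0) (h1 : X 1 = Y 1) (h2 : X 2 = Y 2) : X = Y := by
  ext i; fin_cases i
  · exact h0
  · exact h1
  · exact h2

lemma vA {g} (hg : g ∈ P.Γ) (h : g P.A ∈ P.tS 1) : g P.A = P.A ∨ g P.A = P.r 1 P.A := by
  have h2 := P.two_of_tS h
  have e := P.eq_case P.K_A hg h2
  have e0 : |(g P.A) 0| = 0 := congrFun e 0
  have e1 : |(g P.A) 1| = P.A 1 := congrFun e 1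
  have f0 := abs_eq_zero.1 e0
  rcases abs_choice ((g P.A) 1) with h' | h'
  · left; exact ext3 f0 (by rw [← e1, h']) h2
  · right
    rw [r1_apply]
    apply ext3
    · rw [f0]; rfl
    · show _ = - P.A 1
      rw [← e1, h', neg_neg]
    · exact h2

lemma vB {g} (hg : g ∈ P.Γ) (h : g P.B ∈ P.tS 1) : g P.B = P.B ∨ g P.B = P.r 0 P.B := by
  have h2 := P.two_of_tS h
  have e := P.eq_case P.K_B hg h2
  have e0 : |(g P.B) 0| = P.B 0 := congrFun e 0
  have e1 : |(g P.B) 1| = 0 := congrFun e 1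
  have f1 := abs_eq_zero.1 e1
  rcases abs_choice ((g P.B) 0) with h' | h'
  · left; exact ext3 (by rw [← e0, h']) f1 h2
  · right
    rw [r0_apply]
    apply ext3
    · show _ = - P.B 0
      rw [← e0, h', neg_neg]
    · rw [f1]; rfl
    · exact h2

lemma vC {g} (hg : g ∈ P.Γ) (h : g C ∈ P.tS 1) : g C = C := by
  have h2 := P.two_of_tS h
  have e := P.eq_case P.K_C hg h2
  exact ext3 (abs_eq_zero.1 (congrFun e 0)) (abs_eq_zero.1 (congrFun e 1)) h2

lemma seg_nonneg {X : V} (h : X ∈ segment ℝ P.A P.B) : 0 ≤ X 0 ∧ 0 ≤ X 1 := by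
  have ha := P.a_pos; have hb := P.b_pos; have hc := P.c_pos
  obtain ⟨s, t, hs, ht, -, rfl⟩ := P.seg_mem h
  constructor
  · show 0 ≤ P.c / P.a * s
    positivity
  · show 0 ≤ P.c / P.b * t
    positivity

lemma A_one_pos : 0 < P.A 1 := div_pos P.c_pos P.b_pos
lemma B_zero_pos : 0 < P.B 0 := div_pos P.c_pos P.a_pos

lemma sA {g} (hg : g ∈ P.Γ) (h : g P.A ∈ segment ℝ P.A P.B) : g P.A = P.A := by
  rcases P.vA hg (P.seg_sub h) with h' | h'
  · exact h'
  · have := (P.seg_nonneg h).2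
    rw [h', r1_apply] at this
    have h3 := P.A_one_pos
    simp at this; linarith

lemma sB {g} (hg : g ∈ P.Γ) (h : g P.B ∈ segment ℝ P.A P.B) : g P.B = P.B := by
  rcases P.vB hg (P.seg_sub h) with h' | h'
  · exact h'
  · have := (P.seg_nonneg h).1
    rw [h', r0_apply] at this
    have h3 := P.B_zero_pos
    simp at this; linarith

lemma C_not_seg : C ∉ segment ℝ P.A P.B := by
  intro h
  have ha := P.a_pos; have hb := P.b_pos; have hc := P.c_pos
  obtain ⟨s, t, hs, ht, hst, e⟩ := P.seg_mem h
  have e0 : 0 = P.c / P.a * s := congrFun e 0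
  have e1 : 0 = P.c / P.b * t := congrFun e 1
  have h1 : s = 0 := (mul_eq_zero.1 e0.symm).resolve_left (by positivity)
  have h2 : t = 0 := (mul_eq_zero.1 e1.symm).resolve_left (by positivity)
  linarith

lemma A_ne_B : P.A ≠ P.B := by
  intro h
  have := P.B_zero_pos
  rw [← h] at this
  simp [A] at this

lemma A_ne_C : P.A ≠ C := by
  intro h
  have := P.A_one_pos
  rw [h] at this
  simp [C] at this

lemma face_ne (i : Fin 4) : (P.face i).Nonempty := by
  fin_cases i
  · exact ⟨P.A, rfl⟩
  · exact ⟨P.B, rfl⟩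
  · exact ⟨P.A, left_mem_segment _ _ _⟩
  · exact ⟨P.A, P.A_mem⟩

/-- a face as an element of the model poset -/
def fc (g : P.Γ) (i : Fin 4) : P.UP := ⟨g.1 '' P.face i, Or.inr (Or.inr ⟨g.1, g.2, i, rfl⟩)⟩
def bt : P.UP := ⟨∅, Or.inl rfl⟩
def tp : P.UP := ⟨Set.univ, Or.inr (Or.inl rfl)⟩

lemma UP_cases (x : P.UP) : x = P.bt ∨ x = P.tp ∨ ∃ g i, x = P.fc g i := by
  obtain ⟨D, rfl | rfl | ⟨g, hg, i, rfl⟩⟩ := x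
  · exact Or.inl rfl
  · exact Or.inr (Or.inl rfl)
  · exact Or.inr (Or.inr ⟨⟨g, hg⟩, i, rfl⟩)

lemma bt_le (x : P.UP) : P.bt ≤ x := Set.empty_subset _
lemma le_tp (x : P.UP) : x ≤ P.tp := Set.subset_univ _
lemma fc_ne_bt (g i) : P.fc g i ≠ P.bt := by
  intro h
  have : g.1 '' P.face i = ∅ := congrArg Subtype.val h
  exact ((P.face_ne i).image g.1).ne_empty this
lemma fc_ne_tp (g i) : P.fc g i ≠ P.tp := by
  intro h
  have : g.1 '' P.face i = Set.univ := congrArg Subtype.val h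
  exact P.zero_not_S (P.face_S g.2 i (this ▸ Set.mem_univ _))
lemma tp_ne_bt : P.tp ≠ P.bt := by
  intro h
  have : (Set.univ : Set V) = ∅ := congrArg Subtype.val h
  exact Set.empty_ne_univ this.symm

lemma fc_le (g k : P.Γ) (i j : Fin 4) : P.fc g i ≤ P.fc k j ↔
    (k⁻¹ * g).1 '' P.face i ⊆ P.face j := by
  show g.1 '' P.face i ⊆ k.1 '' P.face j ↔ _
  rw [Set.image_subset_iff, Set.image_subset_iff]
  constructor
  · intro h X hX
    obtain ⟨Y, hY, e⟩ := h hX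
    show k.1⁻¹ (g.1 X) ∈ P.face j
    rw [← e, inv_apply_self]; exact hY
  · intro h X hX
    exact ⟨_, h hX, apply_inv_self _ _⟩

/-- action of the group -/
def act (g : P.Γ) : P.UP ≃o P.UP where
  toFun x := ⟨g.1 '' x.1, by
    rcases P.UP_cases x with rfl | rfl | ⟨k, i, rfl⟩
    · left; simp [bt]
    · right; left; exact Set.image_univ_of_surjective g.1.surjective
    · right; right
      exact ⟨g.1 * k.1, (g * k).2, i, by
        simp only [fc, Set.image_image]; rfl⟩⟩
  invFun x := ⟨(g.1⁻¹ : V ≃ₗ[ℝ] V) '' x.1, by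
    rcases P.UP_cases x with rfl | rfl | ⟨k, i, rfl⟩
    · left; simp [bt]
    · right; left; exact Set.image_univ_of_surjective (g.1⁻¹).surjective
    · right; right
      exact ⟨g.1⁻¹ * k.1, (g⁻¹ * k).2, i, by
        simp only [fc, Set.image_image]; rfl⟩⟩
  left_inv x := by
    apply Subtype.ext
    simp only [Set.image_image, inv_apply_self, Set.image_id']
  right_inv x := by
    apply Subtype.ext
    simp only [Set.image_image, apply_inv_self, Set.image_id']
  map_rel_iff' := by
    intro x y
    exact Set.image_subset_image_iff g.1.injective

lemma act_fc (g k : P.Γ) (i) : P.act g (P.fc k i) = P.fc (g * k) i := by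
  apply Subtype.ext
  show g.1 '' (k.1 '' _) = _
  rw [Set.image_image]; rfl

lemma fc2_eq {g k : P.Γ} (hA : g.1 P.A = k.1 P.A) (hB : g.1 P.B = k.1 P.B) :
    P.fc g 2 = P.fc k 2 := by
  apply Subtype.ext
  show g.1 '' segment ℝ P.A P.B = k.1 '' segment ℝ P.A P.B
  have e : ∀ h : P.Γ, h.1 '' segment ℝ P.A P.B = segment ℝ (h.1 P.A) (h.1 P.B) := fun h =>
    image_segment ℝ h.1.toLinearMap.toAffineMap P.A P.B
  rw [e, e, hA, hB]

lemma fc3_eq {g k : P.Γ} : P.fc g 3 = P.fc k 3 ↔ g.1 C = k.1 C := by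
  constructor
  · intro h
    have h1 := (P.fc_le g k 3 3).1 h.le
    have h2 := P.vC (k⁻¹ * g).2 (h1 ⟨C, P.C_mem, rfl⟩)
    have h3 : k.1⁻¹ (g.1 C) = C := h2
    rw [← h3, apply_inv_self, h3]
  · intro h
    apply Subtype.ext
    show g.1 '' P.tS 1 = k.1 '' P.tS 1
    rw [P.tS_smul g.2, P.tS_smul k.2, mul_one, mul_one, P.tS_congr h]

lemma fc0_eq {g k : P.Γ} : P.fc g 0 = P.fc k 0 ↔ g.1 P.A = k.1 P.A := by
  have e : ∀ h : P.Γ, (P.fc h 0).1 = {h.1 P.A} := fun h => Set.image_singleton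
  constructor
  · intro h
    have h1 := congrArg Subtype.val h
    rw [e, e] at h1
    exact Set.singleton_injective h1
  · intro h
    apply Subtype.ext
    rw [e, e, h]

lemma fc1_eq {g k : P.Γ} : P.fc g 1 = P.fc k 1 ↔ g.1 P.B = k.1 P.B := by
  have e : ∀ h : P.Γ, (P.fc h 1).1 = {h.1 P.B} := fun h => Set.image_singleton
  constructor
  · intro h
    have h1 := congrArg Subtype.val h
    rw [e, e] at h1
    exact Set.singleton_injective h1
  · intro h
    apply Subtype.ext
    rw [e, e, h]

/-- rank of a representative face -/
def frk : Fin 4 → ℕ := ![1, 1, 2, 3]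

lemma fc_strict {g k : P.Γ} {i j : Fin 4} (hle : P.fc g i ≤ P.fc k j) (hr : frk j ≤ frk i) :
    P.fc g i = P.fc k j := by
  have h := (P.fc_le g k i j).1 hle
  have inv : ∀ {X Y : V}, (k⁻¹ * g).1 X = Y → g.1 X = k.1 Y := by
    intro X Y hX
    have : k.1⁻¹ (g.1 X) = Y := hX
    rw [← this, apply_inv_self]
  have img : ∀ {X : V}, X ∈ P.face i → (k⁻¹ * g).1 X ∈ P.face j := fun hX => h ⟨_, hX, rfl⟩
  have inj := (k⁻¹ * g).1.injective
  have noseg : ∀ Z : V, P.face i = segment ℝ P.A P.B → P.face j = {Z} → False := by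
    intro Z h1 h2
    rw [h1, h2] at img
    have e1 : _ = Z := img (left_mem_segment ℝ _ _)
    have e2 : _ = Z := img (right_mem_segment ℝ _ _)
    exact P.A_ne_B (inj (e1.trans e2.symm))
  have notil : ∀ Z : V, P.face i = P.tS 1 → P.face j = {Z} → False := by
    intro Z h1 h2
    rw [h1, h2] at img
    have e1 : _ = Z := img P.A_mem
    have e2 : _ = Z := img P.C_mem
    exact P.A_ne_C (inj (e1.trans e2.symm))
  have eqc : ∀ Y Z : V, P.face i = {Y} → P.face j = {Z} → P.fc g i = P.fc k j := by
    intro Y Z h1 h2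
    rw [h1, h2] at img
    have e1 : _ = Z := img rfl
    apply Subtype.ext
    show g.1 '' P.face i = k.1 '' P.face j
    rw [h1, h2, Set.image_singleton, Set.image_singleton, inv e1]
  fin_cases i <;> fin_cases j <;> first
    | exact absurd hr (by decide)
    | exact eqc _ _ rfl rfl
    | exact (noseg _ rfl rfl).elim
    | exact (notil _ rfl rfl).elim
    | skip
  · exact P.fc2_eq (inv (P.sA (k⁻¹ * g).2 (img (left_mem_segment ℝ _ _))))
      (inv (P.sB (k⁻¹ * g).2 (img (right_mem_segment ℝ _ _))))
  · have h1 : (k⁻¹ * g).1 C ∈ segment ℝ P.A P.B := img P.C_mem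
    have h2 := P.vC (k⁻¹ * g).2 (P.seg_sub h1)
    rw [h2] at h1
    exact (P.C_not_seg h1).elim
  · exact P.fc3_eq.2 (inv (P.vC (k⁻¹ * g).2 (img P.C_mem)))

open Classical in
/-- rank function on the model poset -/
def rk (x : P.UP) : ℕ :=
  if x = P.bt then 0 else if x = P.tp then 4 else
    if h : ∃ i, ∃ g, x = P.fc g i then frk h.choose else 0

lemma rk_bt : P.rk P.bt = 0 := by simp [rk]
lemma rk_tp : P.rk P.tp = 4 := by simp [rk, P.tp_ne_bt]
lemma rk_fc (g i) : P.rk (P.fc g i) = frk i := by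
  have h : ∃ j, ∃ k, P.fc g i = P.fc k j := ⟨i, g, rfl⟩
  have e : P.rk (P.fc g i) = frk h.choose := by
    unfold rk
    rw [if_neg (P.fc_ne_bt g i), if_neg (P.fc_ne_tp g i), dif_pos h]
  rw [e]
  obtain ⟨k, hk⟩ := h.choose_spec
  generalize h.choose = j at hk
  by_contra hne
  have aux : ∀ (g k : P.Γ) (i j : Fin 4), frk i < frk j → P.fc k j ≠ P.fc g i := by
    intro g k i j hlt heq
    fin_cases i <;> fin_cases j <;> first
      | exact absurd hlt (by decide)
      | skip
    all_goals
      have hle := (P.fc_le k g _ _).1 heq.le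
      have img := fun X hX => hle ⟨X, hX, rfl⟩
      have inj := (g⁻¹ * k).1.injective
    · exact P.A_ne_B (inj ((img P.A (left_mem_segment ℝ _ _) : _ = P.A).trans
        (img P.B (right_mem_segment ℝ _ _) : _ = P.A).symm))
    · exact P.A_ne_C (inj ((img P.A P.A_mem : _ = P.A).trans
        (img C P.C_mem : _ = P.A).symm))
    · exact P.A_ne_B (inj ((img P.A (left_mem_segment ℝ _ _) : _ = P.B).trans
        (img P.B (right_mem_segment ℝ _ _) : _ = P.B).symm))
    · exact P.A_ne_C (inj ((img P.A P.A_mem : _ = P.B).trans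
        (img C P.C_mem : _ = P.B).symm))
    · have h1 : (g⁻¹ * k).1 C ∈ segment ℝ P.A P.B := img C P.C_mem
      have h2 := P.vC (g⁻¹ * k).2 (P.seg_sub h1)
      rw [h2] at h1
      exact P.C_not_seg h1
  rcases Nat.lt_or_gt_of_ne hne with h | h
  · exact aux _ _ _ _ h hk
  · exact aux _ _ _ _ h hk.symm

lemma fc0_le2 (g) : P.fc g 0 ≤ P.fc g 2 :=
  Set.image_mono (Set.singleton_subset_iff.2 (left_mem_segment ℝ _ _))
lemma fc1_le2 (g) : P.fc g 1 ≤ P.fc g 2 :=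
  Set.image_mono (Set.singleton_subset_iff.2 (right_mem_segment ℝ _ _))
lemma fc_le3 (g i) : P.fc g i ≤ P.fc g 3 := Set.image_mono (P.face_sub i)

lemma r0A : P.r 0 P.A = P.A := by rw [r0_apply]; simp [A]
lemma r1B : P.r 1 P.B = P.B := by rw [r1_apply]; simp [B]
lemma r0C : P.r 0 C = C := by rw [r0_apply]; simp [C]
lemma r1C : P.r 1 C = C := by rw [r1_apply]; simp [C]

/-- reflections as group elements -/
def R (i : Fin 3) : P.Γ := ⟨P.r i, P.r_mem i⟩

lemma isRk : Rk P.UP P.rk P.bt P.tp where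
  mono := by
    intro x y hxy
    rcases P.UP_cases y with rfl | rfl | ⟨k, j, rfl⟩
    · exact absurd (lt_of_lt_of_le hxy (P.bt_le x)) (lt_irrefl _)
    · rw [rk_tp]
      rcases P.UP_cases x with rfl | rfl | ⟨g, i, rfl⟩
      · rw [rk_bt]; norm_num
      · exact absurd hxy (lt_irrefl _)
      · rw [rk_fc]; fin_cases i <;> decide
    · rw [rk_fc]
      rcases P.UP_cases x with rfl | rfl | ⟨g, i, rfl⟩
      · rw [rk_bt]; fin_cases j <;> decide
      · exact absurd (lt_of_lt_of_le hxy (P.le_tp _)) (lt_irrefl _)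
      · rw [rk_fc]
        by_contra hcon
        exact hxy.ne (P.fc_strict hxy.le (not_lt.1 hcon))
  gap := by
    intro x y hxy hr
    have mk : ∀ z, x ≤ z → z ≤ y → P.rk x ≠ P.rk z → P.rk z ≠ P.rk y →
        ∃ z, x < z ∧ z < y := fun z h1 h2 h3 h4 =>
      ⟨z, lt_of_le_of_ne h1 (by rintro rfl; exact h3 rfl),
        lt_of_le_of_ne h2 (by rintro rfl; exact h4 rfl)⟩
    rcases P.UP_cases y with rfl | rfl | ⟨k, j, rfl⟩
    · rw [rk_bt] at hr; omega
    · rcases P.UP_cases x with rfl | rfl | ⟨g, i, rfl⟩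
      · exact mk (P.fc 1 0) (P.bt_le _) (P.le_tp _) (by rw [rk_bt, rk_fc]; decide)
          (by rw [rk_tp, rk_fc]; decide)
      · omega
      · refine mk (P.fc g 3) (P.fc_le3 g i) (P.le_tp _) ?_ (by rw [rk_tp, rk_fc]; decide)
        rw [rk_fc, rk_tp] at hr
        rw [rk_fc, rk_fc]
        fin_cases i
        · decide
        · decide
        · decide
        · exact absurd hr (by decide)
    · rcases P.UP_cases x with rfl | rfl | ⟨g, i, rfl⟩
      · rw [rk_bt, rk_fc] at hr
        fin_cases j
        · exact absurd hr (by decide)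
        · exact absurd hr (by decide)
        · exact mk (P.fc k 0) (P.bt_le _) (P.fc0_le2 k) (by rw [rk_bt, rk_fc]; decide)
            (by rw [rk_fc, rk_fc]; decide)
        · exact mk (P.fc k 0) (P.bt_le _) (P.fc_le3 k 0) (by rw [rk_bt, rk_fc]; decide)
            (by rw [rk_fc, rk_fc]; decide)
      · rw [rk_tp, rk_fc] at hr
        fin_cases j <;> exact absurd hr (by decide)
      · have h := (P.fc_le g k i j).1 hxy.le
        have inv : ∀ {X Y : V}, (k⁻¹ * g).1 X = Y → g.1 X = k.1 Y := by
          intro X Y hX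
          have : k.1⁻¹ (g.1 X) = Y := hX
          rw [← this, apply_inv_self]
        rw [rk_fc, rk_fc] at hr
        have fin : ∀ m : P.Γ, P.fc g i ≤ P.fc (k * m) 2 → m.1 C = C → frk i = 1 → j = 3 →
            ∃ z, P.fc g i < z ∧ z < P.fc k j := by
          intro m h1 h2 h3 h4
          subst h4
          refine mk (P.fc (k * m) 2) h1 ?_ (by rw [rk_fc, rk_fc, h3]; decide)
            (by rw [rk_fc, rk_fc]; decide)
          refine (P.fc_le3 (k * m) 2).trans (P.fc3_eq.2 ?_).le
          show k.1 (m.1 C) = k.1 C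
          rw [h2]
        fin_cases i <;> fin_cases j <;> first
          | exact absurd hr (by decide)
          | skip
        · have h1 : (k⁻¹ * g).1 P.A ∈ P.tS 1 := h ⟨P.A, rfl, rfl⟩
          rcases P.vA (k⁻¹ * g).2 h1 with e | e
          · exact fin 1 ((P.fc0_eq.2 (inv e)).le.trans (P.fc0_le2 _)) rfl rfl rfl
          · exact fin (P.R 1) (((P.fc0_eq (g := g) (k := k * P.R 1)).2 (inv e)).le.trans (P.fc0_le2 _)) P.r1C rfl rfl
        · have h1 : (k⁻¹ * g).1 P.B ∈ P.tS 1 := h ⟨P.B, rfl, rfl⟩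
          rcases P.vB (k⁻¹ * g).2 h1 with e | e
          · exact fin 1 ((P.fc1_eq.2 (inv e)).le.trans (P.fc1_le2 _)) rfl rfl rfl
          · exact fin (P.R 0) (((P.fc1_eq (g := g) (k := k * P.R 0)).2 (inv e)).le.trans (P.fc1_le2 _)) P.r0C rfl rfl
  bot := P.bt_le
  top := P.le_tp
  rb := P.rk_bt
  rt := P.rk_tp

lemma of_rk3 {x : P.UP} (h : P.rk x = 3) : ∃ g, x = P.fc g 3 := by
  rcases P.UP_cases x with rfl | rfl | ⟨g, i, rfl⟩
  · rw [rk_bt] at h; omega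
  · rw [rk_tp] at h; omega
  · rw [rk_fc] at h
    fin_cases i <;> first
      | exact absurd h (by decide)
      | exact ⟨g, rfl⟩

lemma of_rk2 {x : P.UP} (h : P.rk x = 2) : ∃ g, x = P.fc g 2 := by
  rcases P.UP_cases x with rfl | rfl | ⟨g, i, rfl⟩
  · rw [rk_bt] at h; omega
  · rw [rk_tp] at h; omega
  · rw [rk_fc] at h
    fin_cases i <;> first
      | exact absurd h (by decide)
      | exact ⟨g, rfl⟩

lemma of_rk1 {x : P.UP} (h : P.rk x = 1) : ∃ g, x = P.fc g 0 ∨ x = P.fc g 1 := by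
  rcases P.UP_cases x with rfl | rfl | ⟨g, i, rfl⟩
  · rw [rk_bt] at h; omega
  · rw [rk_tp] at h; omega
  · rw [rk_fc] at h
    fin_cases i <;> first
      | exact absurd h (by decide)
      | exact ⟨g, Or.inl rfl⟩
      | exact ⟨g, Or.inr rfl⟩

lemma trans_flags (x1 x2 x3 : P.UP) (h1 : P.rk x1 = 1) (h2 : P.rk x2 = 2) (h3 : P.rk x3 = 3)
    (h12 : x1 ≤ x2) (h23 : x2 ≤ x3) :
    ∃ γ : P.UP ≃o P.UP, (γ x1 = P.fc 1 0 ∨ γ x1 = P.fc 1 1) ∧ γ x2 = P.fc 1 2 ∧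
      γ x3 = P.fc 1 3 := by
  obtain ⟨g, rfl⟩ := P.of_rk3 h3
  obtain ⟨k, rfl⟩ := P.of_rk2 h2
  obtain ⟨l, hl⟩ := P.of_rk1 h1
  have h := (P.fc_le _ _ _ _).1 h23
  have hA : (g⁻¹ * k).1 P.A ∈ P.tS 1 := h ⟨P.A, left_mem_segment ℝ _ _, rfl⟩
  have hB : (g⁻¹ * k).1 P.B ∈ P.tS 1 := h ⟨P.B, right_mem_segment ℝ _ _, rfl⟩
  obtain ⟨s, sC, sA, sB⟩ : ∃ s : P.Γ, s.1 C = C ∧ (s * (g⁻¹ * k)).1 P.A = P.A ∧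
      (s * (g⁻¹ * k)).1 P.B = P.B := by
    have e : ∀ s : P.Γ, ∀ X, (s * (g⁻¹ * k)).1 X = s.1 ((g⁻¹ * k).1 X) := fun _ _ => rfl
    simp only [e]
    rcases P.vA (g⁻¹ * k).2 hA with e1 | e1 <;> rcases P.vB (g⁻¹ * k).2 hB with e2 | e2 <;>
      rw [e1, e2]
    · exact ⟨1, rfl, rfl, rfl⟩
    · exact ⟨P.R 0, P.r0C, P.r0A, P.r_r 0 _⟩
    · exact ⟨P.R 1, P.r1C, P.r_r 1 _, P.r1B⟩
    · refine ⟨P.R 0 * P.R 1, ?_, ?_, ?_⟩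
      · show P.r 0 (P.r 1 C) = C
        rw [r1C, r0C]
      · show P.r 0 (P.r 1 (P.r 1 P.A)) = P.A
        rw [r_r, r0A]
      · show P.r 0 (P.r 1 (P.r 0 P.B)) = P.B
        have : P.r 1 (P.r 0 P.B) = P.r 0 P.B := by rw [r0_apply, r1_apply]; simp [B]
        rw [this, r_r]
  have f2 : P.fc (s * g⁻¹ * k) 2 = P.fc 1 2 := by
    rw [mul_assoc]; exact P.fc2_eq sA sB
  refine ⟨P.act (s * g⁻¹), ?_, ?_, ?_⟩
  · have hle := (P.act (s * g⁻¹)).monotone h12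
    rw [act_fc, f2] at hle
    rcases hl with rfl | rfl
    · left
      rw [act_fc] at hle ⊢
      have := (P.fc_le _ _ _ _).1 hle
      rw [inv_one, one_mul] at this
      exact P.fc0_eq.2 (P.sA (s * g⁻¹ * l).2 (this ⟨P.A, rfl, rfl⟩))
    · right
      rw [act_fc] at hle ⊢
      have := (P.fc_le _ _ _ _).1 hle
      rw [inv_one, one_mul] at this
      exact P.fc1_eq.2 (P.sB (s * g⁻¹ * l).2 (this ⟨P.B, rfl, rfl⟩))
  · rw [act_fc, f2]
  · rw [act_fc, inv_mul_cancel_right]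
    exact P.fc3_eq.2 sC

end Par
end TwoOrb
end

noncomputable section
namespace TwoOrb
namespace Par
variable (P : Par)

/-- angle of the dihedral group at a vertex -/
def th (s : Fin 3) : ℝ := Real.pi / P.m s 2
/-- unit vector orthogonal to the root `s` -/
def e2 (s : Fin 3) : V := (Real.sin (P.th s))⁻¹ • (P.rt 2 + Real.cos (P.th s) • P.rt s)
/-- radius of the orbit -/
def dd (s : Fin 3) : ℝ := P.c / Real.sin (P.th s)
/-- rotated copies of the centre -/
def pt (s : Fin 3) (x : ℝ) : V :=
  C + (P.dd s) • ((Real.cos x - 1) • P.e2 s + Real.sin x • P.rt s)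

section
variable {s : Fin 3}

lemma Q_C_rt (hs : s ≠ 2) : Q C (P.rt s) = 0 := by
  fin_cases s
  · simp [Q, C, rt]
  · simp [Q, C, rt]
  · exact absurd rfl hs

lemma Q_C_rt2 : Q C (P.rt 2) = P.c := by simp [Q, C, rt]

lemma sin_th (hs : s ≠ 2) : 0 < Real.sin (P.th s) := P.sin_pos' s 2 hs
lemma dd_pos (hs : s ≠ 2) : 0 < P.dd s := div_pos P.c_pos (P.sin_th hs)

lemma Q_e2_rt (hs : s ≠ 2) : Q (P.e2 s) (P.rt s) = 0 := by
  rw [e2, Q_smul_left, Q_add_left, Q_smul_left, Q_rt_self, Q_rt P 2 s hs.symm, m_symm]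
  unfold th; ring

lemma Q_e2_rt2 (hs : s ≠ 2) : Q (P.e2 s) (P.rt 2) = Real.sin (P.th s) := by
  have h := P.sin_th hs
  rw [e2, Q_smul_left, Q_add_left, Q_smul_left, Q_rt_self, Q_rt P s 2 hs]
  have h2 := Real.sin_sq_add_cos_sq (P.th s)
  rw [← th]
  field_simp
  linarith

lemma Q_e2_e2 (hs : s ≠ 2) : Q (P.e2 s) (P.e2 s) = 1 := by
  have h := P.sin_th hs
  have key : ∀ Y, Q (P.e2 s) Y = (Real.sin (P.th s))⁻¹ * (Q (P.rt 2) Y +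
      Real.cos (P.th s) * Q (P.rt s) Y) := by
    intro Y
    rw [e2, Q_smul_left, Q_add_left, Q_smul_left]
  rw [key, Q_comm, P.Q_e2_rt2 hs, Q_comm (P.rt s), P.Q_e2_rt hs]
  field_simp
  ring

lemma rt2_eq (hs : s ≠ 2) : P.rt 2 = Real.sin (P.th s) • P.e2 s - Real.cos (P.th s) • P.rt s := by
  have h := P.sin_th hs
  rw [e2, smul_smul, mul_inv_cancel₀ h.ne']; module

lemma Q_C_e2 (hs : s ≠ 2) : Q C (P.e2 s) = P.dd s := by
  rw [e2, Q_smul_right, Q_add_right, Q_smul_right, P.Q_C_rt hs, Q_C_rt2, dd]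
  field_simp
  ring

lemma Q_pt_rt (hs : s ≠ 2) (x) : Q (P.pt s x) (P.rt s) = P.dd s * Real.sin x := by
  rw [pt, Q_add_left, Q_smul_left, Q_add_left, Q_smul_left, Q_smul_left, P.Q_C_rt hs,
    P.Q_e2_rt hs, Q_rt_self]; ring

lemma Q_pt_e2 (hs : s ≠ 2) (x) : Q (P.pt s x) (P.e2 s) = P.dd s * Real.cos x := by
  rw [pt, Q_add_left, Q_smul_left, Q_add_left, Q_smul_left, Q_smul_left, P.Q_C_e2 hs,
    P.Q_e2_e2 hs, Q_comm (P.rt s), P.Q_e2_rt hs]; ring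

lemma rs_pt (hs : s ≠ 2) (x) : P.r s (P.pt s x) = P.pt s (-x) := by
  rw [r_apply, P.Q_pt_rt hs, pt, pt, Real.cos_neg, Real.sin_neg]
  module

lemma r2_pt (hs : s ≠ 2) (x) : P.r 2 (P.pt s x) = P.pt s (2 * P.th s - x) := by
  have h1 : Q (P.pt s x) (P.rt 2) = P.dd s * Real.sin (P.th s - x) := by
    rw [P.rt2_eq hs, Q_sub_right, Q_smul_right, Q_smul_right, P.Q_pt_rt hs, P.Q_pt_e2 hs,
      Real.sin_sub]; ring
  have e1 : 2 * P.th s - x = P.th s + (P.th s - x) := by ring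
  have e2 : x = P.th s - (P.th s - x) := by ring
  rw [r_apply, h1, pt, pt, e1]
  conv_lhs => rw [P.rt2_eq hs]
  generalize hy : P.th s - x = y at *
  rw [e2, Real.cos_add, Real.sin_add, Real.cos_sub, Real.sin_sub]
  module

lemma pt_zero : P.pt s 0 = C := by simp [pt]

lemma pt_inj (hs : s ≠ 2) {x y : ℝ} (h : P.pt s x = P.pt s y) : ∃ n : ℤ, x - y = 2 * Real.pi * n := by
  have hd := (P.dd_pos hs).ne'
  have h1 := P.Q_pt_rt hs x
  rw [h, P.Q_pt_rt hs] at h1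
  have h2 := P.Q_pt_e2 hs x
  rw [h, P.Q_pt_e2 hs] at h2
  exact Real.Angle.angle_eq_iff_two_pi_dvd_sub.1
    (Real.Angle.cos_sin_inj (mul_left_cancel₀ hd h2).symm (mul_left_cancel₀ hd h1).symm)

lemma m_th (hs : s ≠ 2) : (P.m s 2 : ℝ) * P.th s = Real.pi := by
  have : (P.m s 2 : ℝ) ≠ 0 := by
    have := P.two_le_m s 2 hs
    positivity
  unfold th; field_simp

/-- the orbit as an integer indexed family -/
def pz (s : Fin 3) (j : ℤ) : V := P.pt s (2 * j * P.th s)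

lemma rs_pz (hs : s ≠ 2) (j) : P.r s (P.pz s j) = P.pz s (-j) := by
  rw [pz, P.rs_pt hs, pz]; congr 1; push_cast; ring
lemma r2_pz (hs : s ≠ 2) (j) : P.r 2 (P.pz s j) = P.pz s (1 - j) := by
  rw [pz, P.r2_pt hs, pz]; congr 1; push_cast; ring
lemma pz_zero : P.pz s 0 = C := by simp [pz, pt_zero]
lemma pz_eq (hs : s ≠ 2) {i j : ℤ} (h : P.pz s i = P.pz s j) : ∃ n : ℤ, i - j = P.m s 2 * n := by
  obtain ⟨n, hn⟩ := P.pt_inj hs h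
  refine ⟨n, ?_⟩
  rw [← P.m_th hs] at hn
  have ht : P.th s ≠ 0 := by
    intro h0
    have := P.m_th hs
    rw [h0, mul_zero] at this
    exact Real.pi_pos.ne this
  have : ((i - j : ℤ) : ℝ) = ((P.m s 2 * n : ℤ) : ℝ) := by
    push_cast
    apply mul_right_cancel₀ (mul_ne_zero two_ne_zero ht)
    linarith
  exact_mod_cast this
lemma pz_mod (hs : s ≠ 2) (j : ℤ) : P.pz s (j % P.m s 2) = P.pz s j := by
  have e : 2 * (j : ℝ) * P.th s = 2 * ((j % P.m s 2 : ℤ) : ℝ) * P.th s +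
      ((j / P.m s 2 : ℤ) : ℝ) * (2 * Real.pi) := by
    have h1 : (j : ℝ) = ((j % P.m s 2 : ℤ) : ℝ) + (P.m s 2 : ℝ) * ((j / P.m s 2 : ℤ) : ℝ) := by
      exact_mod_cast (Int.emod_add_mul_ediv j (P.m s 2)).symm
    rw [← P.m_th hs]
    nth_rw 1 [h1]
    ring
  unfold pz pt
  rw [e, Real.cos_add_int_mul_two_pi, Real.sin_add_int_mul_two_pi]

/-- rotation at a vertex -/
def rot (s : Fin 3) : P.Γ := P.R 2 * P.R s

lemma rot_pow (hs : s ≠ 2) (j : ℕ) : ((P.rot s) ^ j).1 C = P.pz s j := by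
  induction j with
  | zero => exact P.pz_zero.symm
  | succ j ih =>
    rw [pow_succ']
    show P.r 2 (P.r s (((P.rot s) ^ j).1 C)) = _
    rw [ih, P.rs_pz hs, P.r2_pz hs]
    congr 1; push_cast; ring

lemma orbit {s s' : Fin 3} (hs : s ≠ 2) (hc : ∀ i, i = s ∨ i = s' ∨ i = 2) {X : V} (hK : P.K X)
    (h1 : Q X (P.rt s) = 0) (h2 : Q X (P.rt 2) = 0) (h3 : 0 < Q X (P.rt s'))
    (h4 : Q X C = -1) {g} (hg : g ∈ P.Γ) (hX : Q X (g C) = -1) : ∃ j, g C = P.pz s j := by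
  by_contra hcon
  set bad : Set (V ≃ₗ[ℝ] V) := {k | k ∈ P.Γ ∧ - Q P.x0 (k C) ≤ - Q P.x0 (g C) ∧
    Q X (k C) = -1 ∧ ¬ ∃ j, k C = P.pz s j}
  have hf : bad.Finite := (P.disc' fwd_C (- Q P.x0 (g C))).subset fun k hk => ⟨hk.1, hk.2.1⟩
  obtain ⟨k, ⟨k1, k2, k3, k4⟩, kmin⟩ := bad.exists_min_image (fun k => - Q P.x0 (k C)) hf
    ⟨g, hg, le_rfl, hX, hcon⟩
  have hQ : ∀ i, Q X (P.r i (k C)) = -1 - 2 * Q (k C) (P.rt i) * Q X (P.rt i) := by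
    intro i
    rw [r_apply, Q_sub_right, Q_smul_right, k3]
  by_cases hKk : P.K (k C)
  · exact k4 ⟨0, by rw [P.K_unique P.K_C k1 hKk, pz_zero]⟩
  · unfold K at hKk
    push Not at hKk
    obtain ⟨i, hi⟩ := hKk
    have hlt := P.Q_x0_r _ i hi
    have step : Q X (P.rt i) = 0 → ∃ j, P.r i (k C) = P.pz s j := by
      intro h0
      by_contra hn
      have := kmin (P.r i * k) ⟨P.Γ.mul_mem (P.r_mem i) k1, hlt.le.trans k2, by
        show Q X (P.r i (k C)) = -1
        rw [hQ, h0]; ring, hn⟩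
      exact absurd hlt (not_lt.2 this)
    rcases hc i with rfl | rfl | rfl
    · obtain ⟨j, hj⟩ := step h1
      exact k4 ⟨-j, by rw [← P.rs_pz hs, ← hj, r_r]⟩
    · have := P.main_le hK P.K_C (P.Γ.mul_mem (P.r_mem i) k1)
      rw [h4] at this
      have h5 : Q X (P.r i (k C)) ≤ -1 := this
      rw [hQ] at h5
      have := mul_neg_of_neg_of_pos hi h3
      linarith
    · obtain ⟨j, hj⟩ := step h2
      exact k4 ⟨1 - j, by rw [← P.r2_pz hs, ← hj, r_r]⟩

lemma deg_gen {s s' : Fin 3} (hs : s ≠ 2) (hc : ∀ i, i = s ∨ i = s' ∨ i = 2) {X : V} (hK : P.K X)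
    (h1 : Q X (P.rt s) = 0) (h2 : Q X (P.rt 2) = 0) (h3 : 0 < Q X (P.rt s'))
    (h4 : Q X C = -1) (i : Fin 4) (hi : P.face i = {X}) (g : P.Γ) :
    deg (P.fc g i) = P.m s 2 := by
  have e : P.fc g i = P.act g (P.fc 1 i) := by rw [act_fc, mul_one]
  rw [e, deg_map]
  have hm := P.two_le_m s 2 hs
  have hXm : X ∈ P.tS 1 := P.face_sub i (by rw [hi]; rfl)
  have hmem : ∀ γ : P.Γ, P.fc 1 i ≤ P.fc γ 3 ↔ Q X (γ.1 C) = -1 := by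
    intro γ
    have : P.fc 1 i ≤ P.fc γ 3 ↔ (1 : P.Γ).1 '' P.face i ⊆ γ.1 '' P.tS 1 := Iff.rfl
    rw [this, P.tS_smul γ.2, mul_one, hi, Set.image_singleton, Set.singleton_subset_iff]
    show (∀ k ∈ P.Γ, Q (k C) X ≤ -1) ∧ Q (γ.1 C) X = -1 ↔ _
    rw [Q_comm X]
    exact ⟨fun h => h.2, fun h => ⟨hXm.1, h⟩⟩
  have hset : {t | P.fc 1 i ≤ t ∧ CoAt t} =
      (fun j : ℕ => P.fc ((P.rot s) ^ j) 3) '' Set.Iio (P.m s 2) := by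
    ext t
    constructor
    · rintro ⟨ht, hco⟩
      obtain ⟨γ, rfl⟩ := P.of_rk3 ((P.isRk.coat_iff t).1 hco)
      obtain ⟨j, hj⟩ := P.orbit hs hc hK h1 h2 h3 h4 γ.2 ((hmem γ).1 ht)
      have hpos : (0 : ℤ) < P.m s 2 := by omega
      have j0 := Int.emod_nonneg j hpos.ne'
      have j1 := Int.emod_lt_of_pos j hpos
      refine ⟨(j % P.m s 2).toNat, ?_, ?_⟩
      · rw [Set.mem_Iio]
        omega
      · apply P.fc3_eq.2
        rw [P.rot_pow hs, hj, ← P.pz_mod hs j, Int.toNat_of_nonneg j0]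
    · rintro ⟨j, -, rfl⟩
      refine ⟨(hmem _).2 ?_, (P.isRk.coat_iff _).2 (P.rk_fc _ _)⟩
      rw [P.rot_pow hs, pz, pt, Q_add_right, Q_smul_right, Q_add_right, Q_smul_right,
        Q_smul_right, e2, Q_smul_right, Q_add_right, Q_smul_right, h1, h2, h4]
      ring
  unfold deg
  rw [hset, Set.ncard_image_of_injOn]
  · rw [← Finset.coe_Iio, Set.ncard_coe_finset, Nat.card_Iio]
  · intro x hx y hy hxy
    have h := P.fc3_eq.1 hxy
    rw [P.rot_pow hs, P.rot_pow hs] at h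
    obtain ⟨n, hn⟩ := P.pz_eq hs h
    have hx' : x < P.m s 2 := hx
    have hy' : y < P.m s 2 := hy
    have h0 : (x : ℤ) - y = 0 := by
      apply Int.eq_zero_of_abs_lt_dvd (m := P.m s 2) ⟨n, hn⟩
      rw [abs_lt]; omega
    omega
end

lemma deg0 (g : P.Γ) : deg (P.fc g 0) = P.p := by
  have ha := P.a_pos; have hb := P.b_pos
  refine P.deg_gen (s := 0) (s' := 1) (X := P.A) (by decide) (by decide) P.K_A ?_ ?_ ?_ ?_ 0 rfl g
  · rw [Q_rt0]; rfl
  · rw [Q_rt2]; simp [A]; field_simp; ring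
  · rw [Q_rt1]; exact P.A_one_pos
  · rw [Q_C', A_two]

lemma deg1 (g : P.Γ) : deg (P.fc g 1) = P.q := by
  have ha := P.a_pos; have hb := P.b_pos
  refine P.deg_gen (s := 1) (s' := 0) (X := P.B) (by decide) (by decide) P.K_B ?_ ?_ ?_ ?_ 1 rfl g
  · rw [Q_rt1]; rfl
  · rw [Q_rt2]; simp [B]; field_simp; ring
  · rw [Q_rt0]; exact P.B_zero_pos
  · rw [Q_C', B_two]

lemma two (h : P.p ≠ P.q) : TwoFlagOrbits (TPoset P.T) := by
  refine TwoFlagOrbits.map P.isoUP.symm (P.isRk.two_orbits (a1 := P.fc 1 0) (a1' := P.fc 1 1)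
    (a2 := P.fc 1 2) (a3 := P.fc 1 3) (P.rk_fc _ _) (P.rk_fc _ _) (P.rk_fc _ _) (P.rk_fc _ _)
    (P.fc0_le2 1) (P.fc1_le2 1) (P.fc_le3 1 2) ?_ P.trans_flags)
  rw [deg0, deg1]; exact h

/-- the family used in the theorem -/
def fam (n : ℕ) : Par := ⟨5, n + 6, le_rfl, by omega⟩

lemma fam_iso (m n : ℕ) (hmn : m ≠ n) : IsEmpty (TPoset (fam m).T ≃o TPoset (fam n).T) := by
  refine ⟨fun e => ?_⟩
  let f : (fam m).UP ≃o (fam n).UP := (fam m).isoUP.symm.trans (e.trans (fam n).isoUP)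
  have h1 : At ((fam m).fc 1 1) := ((fam m).isRk.at_iff _).2 ((fam m).rk_fc _ _)
  have h2 := ((fam n).isRk.at_iff _).1 (h1.map f)
  have h3 := deg_map ((fam m).fc 1 1) f
  rw [deg1] at h3
  obtain ⟨g, hg | hg⟩ := (fam n).of_rk1 h2
  · rw [hg, deg0] at h3
    have : 5 = m + 6 := h3
    omega
  · rw [hg, deg1] at h3
    have : n + 6 = m + 6 := h3
    omega

end Par
end TwoOrb
end

/-- There are infinitely many combinatorially two-orbit LFC tilings of
`ℝ²` with pairwise non-isomorphic face posets. -/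
theorem infinitely_many_two_orbit_planar_tilings :
    ∃ Ts : ℕ → Set (Set (EucSp 2)),
      (∀ n : ℕ, IsLFCTiling (Ts n) ∧ TwoFlagOrbits (TPoset (Ts n))) ∧
      ∀ m n : ℕ, m ≠ n → IsEmpty (TPoset (Ts m) ≃o TPoset (Ts n)) := by
  exact ⟨fun n => (TwoOrb.Par.fam n).T,
    fun n => ⟨(TwoOrb.Par.fam n).isLFC, (TwoOrb.Par.fam n).two (by
      show 5 ≠ n + 6
      omega)⟩, TwoOrb.Par.fam_iso⟩
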